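/- arXiv:1807.05820 — 7 statements merged into one kernel-verified Lean document; each statement's English description precedes it below -/
import Mathlib

section
/- There exists a constant C > 0 such that for all real H ≥ 2 one has N_{D₄}(H) + N_{V₄}(H) + N_{C₄}(H) ≤ C·H²(log H)². -/
open Polynomial in
/-- The number of monic, irreducible quartic polynomials with integer coefficients
bounded by `H` in absolute value whose Galois group is isomorphic to `G`. -/
noncomputable def quarticGalCount (G : Type*) [Group G] (H : ℝ) : ℕ :=
  Set.ncard {p : ℤ × ℤ × ℤ × ℤ |
    |(p.1 : ℝ)| ≤ H ∧ |(p.2.1 : ℝ)| ≤ H ∧ |(p.2.2.1 : ℝ)| ≤ H ∧ |(p.2.2.2 : ℝ)| ≤ H ∧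
    Irreducible (X ^ 4 + C (p.1 : ℚ) * X ^ 3 + C (p.2.1 : ℚ) * X ^ 2 + C (p.2.2.1 : ℚ) * X
        + C (p.2.2.2 : ℚ)) ∧
    Nonempty
      ((X ^ 4 + C (p.1 : ℚ) * X ^ 3 + C (p.2.1 : ℚ) * X ^ 2 + C (p.2.2.1 : ℚ) * X
          + C (p.2.2.2 : ℚ)).Gal ≃* G)}

section Resolvent

open Polynomial

theorem exists_quartic_roots {K : Type*} [Field K] (f : K[X]) (hf : f.natDegree = 4)
    (hm : f.Monic) (hs : f.Splits) :
    ∃ r s t v : K, f = (X - C r) * (X - C s) * (X - C t) * (X - C v) := by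
  have hc := hs.natDegree_eq_card_roots
  have hp := hs.eq_prod_roots
  rw [hf] at hc
  obtain ⟨r, s, t, v, hr⟩ := Multiset.card_eq_four.1 hc.symm
  refine ⟨r, s, t, v, ?_⟩
  rw [hp, hm.leadingCoeff, hr]
  simp [mul_assoc]

theorem quartic_coeff_ext {K : Type*} [Field K] {a b c d a' b' c' d' : K}
    (h : X ^ 4 + C a * X ^ 3 + C b * X ^ 2 + C c * X + C d =
      X ^ 4 + C a' * X ^ 3 + C b' * X ^ 2 + C c' * X + C d') :
    a = a' ∧ b = b' ∧ c = c' ∧ d = d' := by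
  have h0 := congrArg (fun p => coeff p 0) h
  have h1 := congrArg (fun p => coeff p 1) h
  have h2 := congrArg (fun p => coeff p 2) h
  have h3 := congrArg (fun p => coeff p 3) h
  simp [coeff_X, coeff_C] at h0 h1 h2 h3
  exact ⟨h3, h2, h1, h0⟩

theorem exists_root_resolvent_of_splits {K : Type*} [Field K] (a b c d : K)
    (hs : (X ^ 4 + C a * X ^ 3 + C b * X ^ 2 + C c * X + C d).Splits) :
    ∃ x : K, x ^ 3 - b * x ^ 2 + (a * c - 4 * d) * x - (a ^ 2 * d - 4 * b * d + c ^ 2) = 0 := by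
  obtain ⟨r, s, t, v, h⟩ := exists_quartic_roots _ (by compute_degree!) (by monicity!) hs
  have h' : X ^ 4 + C a * X ^ 3 + C b * X ^ 2 + C c * X + C d =
      X ^ 4 + C (-(r+s+t+v)) * X ^ 3 + C (r*s+r*t+r*v+s*t+s*v+t*v) * X ^ 2
        + C (-(r*s*t+r*s*v+r*t*v+s*t*v)) * X + C (r*s*t*v) := by
    rw [h]; simp only [C_neg, C_add, C_mul]; ring
  obtain ⟨rfl, rfl, rfl, rfl⟩ := quartic_coeff_ext h'
  exact ⟨r * s + t * v, by ring⟩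

theorem exists_int_root_resolvent (a b c d : ℤ)
    (hirr : Irreducible (X ^ 4 + C (a : ℚ) * X ^ 3 + C (b : ℚ) * X ^ 2 + C (c : ℚ) * X
      + C (d : ℚ)))
    (h3 : ¬ 3 ∣ Nat.card (X ^ 4 + C (a : ℚ) * X ^ 3 + C (b : ℚ) * X ^ 2 + C (c : ℚ) * X
      + C (d : ℚ)).Gal) :
    ∃ x : ℤ, x ^ 3 - b * x ^ 2 + (a * c - 4 * d) * x - (a ^ 2 * d - 4 * b * d + c ^ 2) = 0 := by
  set f : ℚ[X] := X ^ 4 + C (a : ℚ) * X ^ 3 + C (b : ℚ) * X ^ 2 + C (c : ℚ) * X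
      + C (d : ℚ) with hf
  obtain ⟨θ, hθ⟩ : ∃ θ : f.SplittingField, θ ^ 3 - (b : f.SplittingField) * θ ^ 2
      + (a * c - 4 * d) * θ - (a ^ 2 * d - 4 * b * d + c ^ 2) = 0 := by
    apply exists_root_resolvent_of_splits
    have hsp := SplittingField.splits f
    have hmap : f.map (algebraMap ℚ f.SplittingField) = X ^ 4 + C (a : f.SplittingField) * X ^ 3
        + C (b : f.SplittingField) * X ^ 2 + C (c : f.SplittingField) * X
        + C (d : f.SplittingField) := by
      conv_lhs => enter [2]; rw [hf]
      simp
    exact (congrArg Polynomial.Splits hmap).mp hsp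
  let r : ℤ[X] := X ^ 3 + C (-b) * X ^ 2 + C (a * c - 4 * d) * X
    + C (-(a ^ 2 * d - 4 * b * d + c ^ 2))
  have hrm : r.Monic := by unfold r; monicity!
  have hrd : r.natDegree = 3 := by unfold r; compute_degree!
  have hroot : ∃ q : ℚ, aeval q r = 0 := by
    by_contra! hno
    have hirr' : Irreducible (r.map (algebraMap ℤ ℚ)) := by
      apply irreducible_of_degree_le_three_of_not_isRoot
      · rw [hrm.natDegree_map, hrd]; simp
      · intro q hq
        apply hno q
        rwa [IsRoot.def, eval_map_algebraMap] at hq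
    have h0 : aeval θ (r.map (algebraMap ℤ ℚ)) = 0 := by
      rw [aeval_map_algebraMap]
      simp only [r, map_add, map_mul, map_pow, aeval_X, aeval_C]
      rw [← hθ]
      simp
      ring
    have hmin := minpoly.eq_of_irreducible_of_monic hirr' h0 (hrm.map _)
    apply h3
    rw [Gal.card_of_separable hirr.separable]
    have := minpoly.degree_dvd (K := ℚ) (Algebra.IsIntegral.isIntegral (R := ℚ) θ)
    rwa [← hmin, hrm.natDegree_map, hrd] at this
  obtain ⟨q, hq⟩ := hroot
  obtain ⟨x, rfl⟩ := isInteger_of_is_root_of_monic hrm hq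
  refine ⟨x, ?_⟩
  rw [aeval_algebraMap_apply] at hq
  have := (algebraMap ℤ ℚ).injective_int (hq.trans (map_zero _).symm)
  simp [r] at this
  linarith

end Resolvent

theorem exists_common_squareclass {n m k : ℤ} (hn : n ≠ 0) (hm : m ≠ 0) (h : n * m = k ^ 2) :
    ∃ u v w : ℤ, u ≠ 0 ∧ v ≠ 0 ∧ w ≠ 0 ∧ n = u * v ^ 2 ∧ m = u * w ^ 2 ∧ k = u * v * w := by
  obtain ⟨g, n', m', hg, hco, hn', hm'⟩ := Int.exists_gcd_one' (Int.gcd_pos_of_ne_zero_left m hn)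
  have hg0 : (g : ℤ) ≠ 0 := by exact_mod_cast hg.ne'
  have hk : (g : ℤ) ∣ k := by
    rw [← Int.pow_dvd_pow_iff (two_ne_zero), ← h, hn', hm']
    exact ⟨n' * m', by ring⟩
  obtain ⟨j, rfl⟩ := hk
  have hj : n' * m' = j ^ 2 := by
    apply mul_left_cancel₀ (pow_ne_zero 2 hg0)
    rw [hn', hm'] at h
    linarith
  have hn0 : n' ≠ 0 := by rintro rfl; simp_all
  have hm0 : m' ≠ 0 := by rintro rfl; simp_all
  obtain ⟨v, hv⟩ := Int.sq_of_gcd_eq_one hco hj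
  obtain ⟨w, hw⟩ := Int.sq_of_gcd_eq_one ((Int.gcd_comm _ _).trans hco)
    ((mul_comm _ _).trans hj)
  have hv0 : v ≠ 0 := by rintro rfl; simp_all
  have hw0 : w ≠ 0 := by rintro rfl; simp_all
  have hvp : 0 < v ^ 2 := by positivity
  have hwp : 0 < w ^ 2 := by positivity
  obtain ⟨e, he, hne, hme⟩ : ∃ e : ℤ, (e = 1 ∨ e = -1) ∧ n' = e * v ^ 2 ∧ m' = e * w ^ 2 := by
    rcases hv with hv | hv <;> rcases hw with hw | hw
    · exact ⟨1, by simp, by simp [hv], by simp [hw]⟩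
    · nlinarith [sq_nonneg j, mul_pos hvp hwp]
    · nlinarith [sq_nonneg j, mul_pos hvp hwp]
    · exact ⟨-1, by simp, by simp [hv], by simp [hw]⟩
  have he2 : e * e = 1 := by rcases he with rfl | rfl <;> rfl
  have he0 : e ≠ 0 := by rintro rfl; simp at he2
  have hjs : (e * j) ^ 2 = (v * w) ^ 2 := by
    rw [mul_pow, ← hj, hne, hme]
    linear_combination (e * e + 1) * (v * w) ^ 2 * he2
  have hj' : j = e * (e * j) := by linear_combination -j * he2
  rcases sq_eq_sq_iff_eq_or_eq_neg.1 hjs with hs | hs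
  · refine ⟨g * e, v, w, mul_ne_zero hg0 he0, hv0, hw0, ?_, ?_, ?_⟩
    · rw [hn', hne]; ring
    · rw [hm', hme]; ring
    · rw [hj', hs]; ring
  · refine ⟨g * e, v, -w, mul_ne_zero hg0 he0, hv0, neg_ne_zero.2 hw0, ?_, ?_, ?_⟩
    · rw [hn', hne]; ring
    · rw [hm', hme]; ring
    · rw [hj', hs]; ring

theorem abs_root_resolvent_le {a b c d x N : ℤ} (hN : 1 ≤ N) (ha : |a| ≤ N) (hb : |b| ≤ N)
    (hc : |c| ≤ N) (hd : |d| ≤ N)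
    (h : x ^ 3 - b * x ^ 2 + (a * c - 4 * d) * x - (a ^ 2 * d - 4 * b * d + c ^ 2) = 0) :
    |x| ≤ 4 * N := by
  by_contra! hx
  have h1 : |x| ^ 3 ≤ N * |x| ^ 2 + (N * N + 4 * N) * |x| + (N ^ 2 * N + 4 * N * N + N ^ 2) := by
    have : x ^ 3 = b * x ^ 2 - (a * c - 4 * d) * x + (a ^ 2 * d - 4 * b * d + c ^ 2) := by
      linarith
    rw [← abs_pow, this]
    have e1 : |b * x ^ 2| ≤ N * |x| ^ 2 := by rw [abs_mul, abs_pow]; gcongr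
    have e2 : |(a * c - 4 * d) * x| ≤ (N * N + 4 * N) * |x| := by
      rw [abs_mul]
      gcongr
      refine (abs_sub _ _).trans ?_
      rw [abs_mul, abs_mul, abs_of_pos (by norm_num : (0 : ℤ) < 4)]
      gcongr
    have e3 : |a ^ 2 * d - 4 * b * d + c ^ 2| ≤ N ^ 2 * N + 4 * N * N + N ^ 2 := by
      refine (abs_add_le _ _).trans (add_le_add ((abs_sub _ _).trans ?_) ?_)
      · rw [abs_mul, abs_mul, abs_mul, abs_pow, abs_of_pos (by norm_num : (0 : ℤ) < 4)]
        gcongr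
      · rw [abs_pow]; gcongr
    exact (abs_add_le _ _).trans (add_le_add ((abs_sub _ _).trans (add_le_add e1 e2)) e3)
  generalize |x| = t at *
  have hNN : N ≤ N * N := by nlinarith
  have ht : 0 < t := by linarith
  have f1 : 4 * (N * t ^ 2) ≤ t ^ 3 := by nlinarith [sq_nonneg t]
  have f2 : 4 * (N * N * t) ≤ N * t ^ 2 := by nlinarith [mul_pos (by linarith : 0 < N) ht]
  have f3 : 4 * (N * N * N) ≤ N * N * t := by nlinarith [mul_pos (by linarith : 0 < N) (by linarith : 0 < N)]
  have f4 : (N * N + 4 * N) * t ≤ 5 * (N * N * t) := by nlinarith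
  have f5 : N ^ 2 * N + 4 * N * N + N ^ 2 ≤ 6 * (N * N * N) := by nlinarith
  have f6 : 0 < t ^ 3 := by positivity
  linarith

/-- The centre of the interval to which the second variable is confined once the first is known. -/
noncomputable def hyperbolaCentre (u v w x : ℝ) : ℝ :=
  if u < 0 ∨ 2 * |x| < |v * √u| then 0 else u * v * w / x

theorem hyperbola_localisation {u v w x a B : ℝ} (hu : u ≠ 0) (hv : v ≠ 0) (hwv : |w| ≤ |v|)
    (h1 : |x ^ 2 - u * v ^ 2| ≤ B) (h2 : |a ^ 2 - u * w ^ 2| ≤ B) (h3 : |a * x - u * v * w| ≤ B) :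
    (|x - v * √u| ≤ B / (|v| * √|u|) ∨ |x - -(v * √u)| ≤ B / (|v| * √|u|)) ∧
      |a - hyperbolaCentre u v w x| ≤ 2 * (B / (|v| * √|u|)) := by
  have hB : 0 ≤ B := (abs_nonneg _).trans h1
  have hden : 0 < |v| * √|u| := by positivity
  set R := B / (|v| * √|u|) with hR
  have hR0 : 0 ≤ R := by positivity
  have hRe : R * (|v| * √|u|) = B := by rw [hR]; field_simp
  have hRsq : R ^ 2 * (|u| * v ^ 2) = B ^ 2 := by
    rw [← hRe, mul_pow, mul_pow, Real.sq_sqrt (abs_nonneg _), sq_abs]; ring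
  have hw2 : w ^ 2 ≤ v ^ 2 := sq_le_sq.2 hwv
  have hv2 : 0 < v ^ 2 := by positivity
  rw [abs_le] at h1 h2
  rcases lt_or_gt_of_ne hu with hneg | hpos
  · have hs : √u = 0 := Real.sqrt_eq_zero_of_nonpos hneg.le
    rw [abs_of_neg hneg] at hRsq
    have hBR : B ≤ R ^ 2 := by
      have : -u * v ^ 2 ≤ B := by nlinarith [sq_nonneg x]
      have hp : 0 < -u * v ^ 2 := mul_pos (by linarith) hv2
      by_contra! hlt
      nlinarith [sq_nonneg R]
    have hx : |x| ≤ R := abs_le_of_sq_le_sq (by nlinarith) hR0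
    have ha : |a| ≤ R := abs_le_of_sq_le_sq (by nlinarith [sq_nonneg w]) hR0
    refine ⟨Or.inl (by simpa [hs] using hx), ?_⟩
    rw [hyperbolaCentre, if_pos (Or.inl hneg), sub_zero]
    linarith
  · rw [abs_of_pos hpos] at hRsq hRe hden
    set s := v * √u with hs
    have hsabs : |s| = |v| * √u := by rw [hs, abs_mul, abs_of_nonneg (Real.sqrt_nonneg u)]
    have hs2 : s ^ 2 = u * v ^ 2 := by rw [hs, mul_pow, Real.sq_sqrt hpos.le]; ring
    rw [← hsabs] at hRe hden
    constructor
    · by_contra! hcon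
      obtain ⟨c1, c2⟩ := hcon
      have hprod : |x - s| * |x - -s| ≤ B := by
        rw [← abs_mul, abs_le, show (x - s) * (x - -s) = x ^ 2 - u * v ^ 2 by rw [← hs2]; ring]
        exact h1
      have hsum : 2 * |s| ≤ |x - s| + |x - -s| := by
        have := abs_sub (x - -s) (x - s)
        rw [show x - -s - (x - s) = 2 * s by ring, abs_mul, abs_two] at this
        linarith
      rcases le_total |s| |x - s| with h | h
      · nlinarith
      · nlinarith
    · rw [hyperbolaCentre]
      split_ifs with hc
      · have hc : 2 * |x| < |s| := hc.resolve_left (by linarith)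
        rw [sub_zero]
        apply abs_le_of_sq_le_sq _ (by positivity)
        have e1 : 4 * x ^ 2 ≤ s ^ 2 := by
          rw [← sq_abs x, ← sq_abs s]; nlinarith [abs_nonneg x]
        have e2 : 3 * s ^ 2 ≤ 4 * B := by linarith
        have e3 : a ^ 2 ≤ B + s ^ 2 := by nlinarith
        rw [← hs2] at hRsq
        have hsp : 0 < s ^ 2 := by rw [← sq_abs]; positivity
        have e4 : 3 * B ≤ 4 * R ^ 2 := by
          by_contra! hlt
          nlinarith [sq_nonneg R]
        linarith
      · push Not at hc
        have hx : 0 < |x| := by linarith [hc.2]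
        have hx0 : x ≠ 0 := abs_pos.1 hx
        rw [show a - u * v * w / x = (a * x - u * v * w) / x by field_simp, abs_div,
          div_le_iff₀ hx]
        nlinarith [hc.2]

/-- The integers at distance at most `r` from `c`. -/
noncomputable def intBall (c r : ℝ) : Finset ℤ := Finset.Icc ⌈c - r⌉ ⌊c + r⌋

theorem mem_intBall {c r : ℝ} {n : ℤ} : n ∈ intBall c r ↔ |(n : ℝ) - c| ≤ r := by
  rw [intBall, Finset.mem_Icc, Int.ceil_le, Int.le_floor, abs_le]
  constructor <;> rintro ⟨_, _⟩ <;> constructor <;> linarith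

theorem card_intBall_le {c r : ℝ} (hr : 0 ≤ r) : ((intBall c r).card : ℝ) ≤ 2 * r + 1 := by
  rw [intBall, Int.card_Icc]
  have h1 := Int.le_ceil (c - r)
  have h2 := Int.floor_le (c + r)
  have h3 : ((⌊c + r⌋ + 1 - ⌈c - r⌉).toNat : ℝ) = ((max (⌊c + r⌋ + 1 - ⌈c - r⌉) 0 : ℤ) : ℝ) := by
    rw [← Int.toNat_eq_max]; rfl
  rw [h3]
  push_cast
  apply max_le <;> linarith

/-- The sum of `1 / |u|` over the nonzero integers `u` with `|u| ≤ M`. -/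
noncomputable def absHarmonic (M : ℕ) : ℝ := ∑ u ∈ Finset.Icc (-(M : ℤ)) M, (|(u : ℝ)|)⁻¹

theorem absHarmonic_eq (M : ℕ) : absHarmonic M = 2 * (harmonic M : ℝ) := by
  induction M with
  | zero => simp [absHarmonic]
  | succ n ih =>
    have : Finset.Icc (-((n + 1 : ℕ) : ℤ)) ((n + 1 : ℕ) : ℤ) =
        insert ((n : ℤ) + 1) (insert (-((n : ℤ) + 1)) (Finset.Icc (-(n : ℤ)) n)) := by
      ext x; simp; omega
    rw [absHarmonic] at ih
    rw [absHarmonic, this, Finset.sum_insert (by simp; omega), Finset.sum_insert (by simp), ih,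
      harmonic_succ]
    have hp : (0 : ℝ) ≤ n + 1 := by positivity
    push_cast
    rw [abs_neg, abs_of_nonneg hp]
    ring

theorem absHarmonic_mono {m n : ℕ} (h : m ≤ n) : absHarmonic m ≤ absHarmonic n := by
  apply Finset.sum_le_sum_of_subset_of_nonneg
  · apply Finset.Icc_subset_Icc <;> omega
  · intros; positivity

theorem two_le_absHarmonic {n : ℕ} (h : 1 ≤ n) : 2 ≤ absHarmonic n := by
  refine le_trans ?_ (absHarmonic_mono h)
  rw [absHarmonic_eq]
  simp

theorem absHarmonic_le (n : ℕ) : absHarmonic n ≤ 2 * (1 + Real.log n) := by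
  rw [absHarmonic_eq]
  gcongr
  exact harmonic_le_one_add_log n

/-- Pairs `(u, v)` with `u, v ≠ 0` and `|u| v² ≤ 36 N²`. -/
noncomputable def hyperbolaBase (N : ℕ) : Finset (ℤ × ℤ) :=
  {p ∈ Finset.Icc (-((36 * N ^ 2 : ℕ) : ℤ)) (36 * N ^ 2 : ℕ) ×ˢ
      Finset.Icc (-((36 * N ^ 2 : ℕ) : ℤ)) (36 * N ^ 2 : ℕ) |
    p.1 ≠ 0 ∧ p.2 ≠ 0 ∧ |p.1| * p.2 ^ 2 ≤ 36 * (N : ℤ) ^ 2}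

open Finset in
/-- Triples `(w, x, a)` containing every solution of the hyperbola system of height `N` with
given `u, v` and `|w| ≤ |v|`. -/
noncomputable def hyperbolaFibre (N : ℕ) (u v : ℤ) : Finset (Σ _ : ℤ, Σ _ : ℤ, ℤ) :=
  (Icc (-|v|) |v|).sigma fun w =>
  (intBall (v * √u) (20 * N / (|(v : ℝ)| * √|(u : ℝ)|)) ∪
    intBall (-(v * √u)) (20 * N / (|(v : ℝ)| * √|(u : ℝ)|))).sigma fun x =>
  intBall (hyperbolaCentre u v w x) (2 * (20 * N / (|(v : ℝ)| * √|(u : ℝ)|)))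

/-- Tuples `(u, v, w, x, a)` containing every solution of the hyperbola system of height `N`
with `|w| ≤ |v|`. -/
noncomputable def hyperbolaTuples (N : ℕ) : Finset (Σ _ : ℤ × ℤ, Σ _ : ℤ, Σ _ : ℤ, ℤ) :=
  (hyperbolaBase N).sigma fun p => hyperbolaFibre N p.1 p.2

theorem mem_hyperbolaTuples {N : ℕ} {u v w x a : ℤ} (hu : u ≠ 0) (hv : v ≠ 0)
    (hwv : |w| ≤ |v|) (huv : |u| * v ^ 2 ≤ 36 * N ^ 2) (h1 : |x ^ 2 - u * v ^ 2| ≤ 20 * N)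
    (h2 : |a ^ 2 - u * w ^ 2| ≤ 20 * N) (h3 : |a * x - u * v * w| ≤ 20 * N) :
    (⟨(u, v), w, x, a⟩ : Σ _ : ℤ × ℤ, Σ _ : ℤ, Σ _ : ℤ, ℤ) ∈ hyperbolaTuples N := by
  have hu1 : 1 ≤ |u| := Int.one_le_abs hu
  have hv1 : 1 ≤ |v| := Int.one_le_abs hv
  have hvsq : |v| ≤ v ^ 2 := by rw [← sq_abs v]; nlinarith
  have hu2 : |u| ≤ 36 * N ^ 2 := by nlinarith
  have hv2 : |v| ≤ 36 * N ^ 2 := by nlinarith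
  have key := hyperbola_localisation (u := u) (v := v) (w := w) (x := x) (a := a) (B := 20 * N)
    (by exact_mod_cast hu) (by exact_mod_cast hv) (by exact_mod_cast hwv)
    (by exact_mod_cast h1) (by exact_mod_cast h2) (by exact_mod_cast h3)
  simp only [hyperbolaTuples, hyperbolaBase, hyperbolaFibre, Finset.mem_sigma,
    Finset.mem_filter, Finset.mem_product, Finset.mem_Icc, Finset.mem_union, mem_intBall, ← abs_le]
  push_cast
  exact ⟨⟨⟨hu2, hv2⟩, hu, hv, huv⟩, hwv, key⟩

theorem card_hyperbolaFibre_le {N : ℕ} {u v : ℤ} (hu : u ≠ 0) (hv : v ≠ 0)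
    (huv : |u| * v ^ 2 ≤ 36 * (N : ℤ) ^ 2) :
    ((hyperbolaFibre N u v).card : ℝ) ≤ 25392 * N ^ 2 * (|(u : ℝ)|⁻¹ * |(v : ℝ)|⁻¹) := by
  have hu' : (0 : ℝ) < |(u : ℝ)| := by positivity
  have hv' : (1 : ℝ) ≤ |(v : ℝ)| := by exact_mod_cast Int.one_le_abs hv
  have hden : 0 < |(v : ℝ)| * √|(u : ℝ)| := by positivity
  have hqsq : (N / (|(v : ℝ)| * √|(u : ℝ)|)) ^ 2 = N ^ 2 * (|(u : ℝ)|⁻¹ * |(v : ℝ)|⁻¹ ^ 2) := by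
    rw [div_pow, mul_pow, Real.sq_sqrt hu'.le]
    field_simp
  have hq1 : 1 ≤ 6 * (N / (|(v : ℝ)| * √|(u : ℝ)|)) := by
    rw [mul_div_assoc', le_div_iff₀ hden, one_mul]
    refine (sq_le_sq₀ hden.le (by positivity)).1 ?_
    rw [mul_pow, Real.sq_sqrt hu'.le, sq_abs, mul_pow]
    have : |(u : ℝ)| * v ^ 2 ≤ 36 * N ^ 2 := by exact_mod_cast huv
    linarith
  rw [hyperbolaFibre, mul_div_assoc]
  set q : ℝ := N / (|(v : ℝ)| * √|(u : ℝ)|)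
  have hq0 : 0 ≤ q := by positivity
  simp only [Finset.card_sigma]
  push_cast
  have inner : ∀ w ∈ Finset.Icc (-|v|) |v|,
      ∑ x ∈ intBall (v * √u) (20 * q) ∪ intBall (-(v * √u)) (20 * q),
        ((intBall (hyperbolaCentre u v w x) (2 * (20 * q))).card : ℝ) ≤ 8464 * q ^ 2 := by
    intro w _
    have e1 : ∀ x ∈ intBall (v * √u) (20 * q) ∪ intBall (-(v * √u)) (20 * q),
        ((intBall (hyperbolaCentre u v w x) (2 * (20 * q))).card : ℝ) ≤ 92 * q := fun x _ =>
      (card_intBall_le (by positivity)).trans (by linarith)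
    have e2 : ((intBall (v * √u) (20 * q) ∪ intBall (-(v * √u)) (20 * q)).card : ℝ) ≤
        92 * q := by
      have h1 := card_intBall_le (c := v * √u) (r := 20 * q) (by positivity)
      have h2 := card_intBall_le (c := -(v * √u)) (r := 20 * q) (by positivity)
      have h3 : ((intBall (v * √u) (20 * q) ∪ intBall (-(v * √u)) (20 * q)).card : ℝ) ≤
        (intBall (v * √u) (20 * q)).card + (intBall (-(v * √u)) (20 * q)).card := by
        exact_mod_cast Finset.card_union_le _ _
      linarith
    refine (Finset.sum_le_card_nsmul _ _ _ e1).trans ?_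
    rw [nsmul_eq_mul]
    nlinarith
  refine (Finset.sum_le_card_nsmul _ _ _ inner).trans ?_
  have hcard : ((Finset.Icc (-|v|) |v|).card : ℝ) ≤ 3 * |(v : ℝ)| := by
    have : (((Finset.Icc (-|v|) |v|).card : ℤ) : ℝ) = ((2 * |v| + 1 : ℤ) : ℝ) := by
      rw [Int.card_Icc, Int.toNat_of_nonneg (by linarith [abs_nonneg v])]
      congr 1; ring
    push_cast at this
    rw [this]; linarith
  rw [nsmul_eq_mul, hqsq]
  calc _ ≤ 3 * |(v : ℝ)| * (8464 * (N ^ 2 * (|(u : ℝ)|⁻¹ * |(v : ℝ)|⁻¹ ^ 2))) := by gcongr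
    _ = _ := by field_simp; ring

theorem card_hyperbolaTuples_le (N : ℕ) :
    ((hyperbolaTuples N).card : ℝ) ≤ 25392 * N ^ 2 * absHarmonic (36 * N ^ 2) ^ 2 := by
  rw [hyperbolaTuples, Finset.card_sigma]
  push_cast
  refine (Finset.sum_le_sum fun p hp => ?_).trans
    ((Finset.sum_le_sum_of_subset_of_nonneg
      (f := fun p : ℤ × ℤ => 25392 * (N : ℝ) ^ 2 * (|(p.1 : ℝ)|⁻¹ * |(p.2 : ℝ)|⁻¹))
      (Finset.filter_subset _ _) fun _ _ _ => by positivity).trans ?_)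
  · obtain ⟨-, hu, hv, huv⟩ := Finset.mem_filter.1 hp
    exact card_hyperbolaFibre_le hu hv huv
  · rw [← Finset.mul_sum, Finset.sum_product, absHarmonic, sq (Finset.sum _ _),
      Finset.sum_mul_sum]

theorem card_Icc_neg (N : ℕ) : ((Finset.Icc (-(N : ℤ)) N).card : ℝ) = 2 * N + 1 := by
  have : (Finset.Icc (-(N : ℤ)) N).card = 2 * N + 1 := by rw [Int.card_Icc]; omega
  rw [this]; push_cast; ring

open Finset in
/-- Triples `(y, b, a)` with `y ≠ 0`, `|y|, |b| ≤ N` and `|(a - g y) y| ≤ N`. -/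
noncomputable def divisorTriples (N : ℕ) (g : ℤ → ℤ) : Finset (Σ _ : ℤ, Σ _ : ℤ, ℤ) :=
  {y ∈ Icc (-(N : ℤ)) N | y ≠ 0}.sigma fun y =>
  (Icc (-(N : ℤ)) N).sigma fun _ => intBall (g y) (N / |(y : ℝ)|)

theorem mem_divisorTriples {N : ℕ} {g : ℤ → ℤ} {y b a : ℤ} (hy0 : y ≠ 0) (hy : |y| ≤ N)
    (hb : |b| ≤ N) (h : |(a - g y) * y| ≤ N) :
    (⟨y, b, a⟩ : Σ _ : ℤ, Σ _ : ℤ, ℤ) ∈ divisorTriples N g := by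
  have hy' : (0 : ℝ) < |(y : ℝ)| := by positivity
  simp only [divisorTriples, Finset.mem_sigma, Finset.mem_filter, Finset.mem_Icc, mem_intBall,
    ← abs_le]
  refine ⟨⟨hy, hy0⟩, hb, ?_⟩
  rw [le_div_iff₀ hy', ← abs_mul]
  exact_mod_cast h

theorem card_divisorTriples_le {N : ℕ} (hN : 1 ≤ N) (g : ℤ → ℤ) :
    ((divisorTriples N g).card : ℝ) ≤ 9 * N ^ 2 * absHarmonic N := by
  have hN' : (1 : ℝ) ≤ N := by exact_mod_cast hN
  rw [divisorTriples, Finset.card_sigma]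
  push_cast
  have step : ∀ y ∈ ({y ∈ Finset.Icc (-(N : ℤ)) N | y ≠ 0} : Finset ℤ),
      ((((Finset.Icc (-(N : ℤ)) N).sigma fun _ => intBall (g y) (N / |(y : ℝ)|)).card : ℕ) : ℝ) ≤
        9 * N ^ 2 * |(y : ℝ)|⁻¹ := by
    intro y hy
    obtain ⟨hyN, hy0⟩ := Finset.mem_filter.1 hy
    have hy' : (0 : ℝ) < |(y : ℝ)| := by positivity
    have hyN' : |(y : ℝ)| ≤ N := by exact_mod_cast abs_le.2 (Finset.mem_Icc.1 hyN)
    rw [Finset.card_sigma, Finset.sum_const, smul_eq_mul]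
    push_cast
    rw [card_Icc_neg]
    have h1 := card_intBall_le (c := g y) (r := N / |(y : ℝ)|) (by positivity)
    have h2 : 1 ≤ N / |(y : ℝ)| := (one_le_div hy').2 hyN'
    calc _ ≤ (3 * N : ℝ) * (3 * (N / |(y : ℝ)|)) := by gcongr <;> linarith
      _ = _ := by ring
  refine (Finset.sum_le_sum step).trans ?_
  refine (Finset.sum_le_sum_of_subset_of_nonneg (Finset.filter_subset _ _)
    fun _ _ _ => by positivity).trans ?_
  rw [← Finset.mul_sum]
  rfl

/-- Coefficient tuples of height at most `N`, with nonzero constant term, of quartics whose cubic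
resolvent has an integer root. -/
def reducibleResolventSet (N : ℕ) : Set (ℤ × ℤ × ℤ × ℤ) :=
  {p | |p.1| ≤ N ∧ |p.2.1| ≤ N ∧ |p.2.2.1| ≤ N ∧ |p.2.2.2| ≤ N ∧ p.2.2.2 ≠ 0 ∧
    ∃ x : ℤ, x ^ 3 - p.2.1 * x ^ 2 + (p.1 * p.2.2.1 - 4 * p.2.2.2) * x
      - (p.1 ^ 2 * p.2.2.2 - 4 * p.2.1 * p.2.2.2 + p.2.2.1 ^ 2) = 0}

open Finset in
/-- A finite set of coefficient tuples covering `reducibleResolventSet N`. -/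
noncomputable def resolventCover (N : ℕ) : Finset (ℤ × ℤ × ℤ × ℤ) :=
  (hyperbolaTuples N).image (fun ⟨(u, v), w, x, a⟩ =>
    (a, (4 * x + a ^ 2 - u * w ^ 2) / 4, (a * x - u * v * w) / 2, (x ^ 2 - u * v ^ 2) / 4)) ∪
  ((hyperbolaTuples N).image (fun ⟨(u, v), w, x, a⟩ =>
    (x, (4 * a + x ^ 2 - u * v ^ 2) / 4, (a * x - u * v * w) / 2, (a ^ 2 - u * w ^ 2) / 4)) ∪
  ((divisorTriples N fun _ => 0).image (fun ⟨y, b, a⟩ => (a, b, a * y, y ^ 2)) ∪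
  ((divisorTriples N fun y => y ^ 2).image (fun ⟨y, d, b⟩ => (2 * y, b, y * (b - y ^ 2), d)) ∪
  (Icc (-(N : ℤ)) N ×ˢ Icc (-(N : ℤ)) N).image (fun q => (0, q.1, 0, q.2)))))

theorem reducibleResolventSet_subset {N : ℕ} (hN : 1 ≤ N) :
    reducibleResolventSet N ⊆ resolventCover N := by
  rintro ⟨a, b, c, d⟩ ⟨ha, hb, hc, hd, hd0, x, hx⟩
  dsimp only at ha hb hc hd hd0 hx
  have hN' : (1 : ℤ) ≤ N := by exact_mod_cast hN
  simp only [resolventCover, Finset.coe_union, Finset.coe_image, Set.mem_union, Set.mem_image,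
    Finset.mem_coe]
  have hxN := abs_root_resolvent_le hN' ha hb hc hd hx
  have hprod : (x ^ 2 - 4 * d) * (4 * x - 4 * b + a ^ 2) = (a * x - 2 * c) ^ 2 := by
    linear_combination 4 * hx
  by_cases hn : x ^ 2 - 4 * d = 0
  · right; right; left
    rw [hn, zero_mul, eq_comm, sq_eq_zero_iff] at hprod
    obtain ⟨y, rfl⟩ : (2 : ℤ) ∣ x :=
      Int.prime_two.dvd_of_dvd_pow (n := 2) ⟨2 * d, by linarith⟩
    obtain rfl : d = y ^ 2 := by linarith
    obtain rfl : c = a * y := by linarith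
    have hy0 : y ≠ 0 := by rintro rfl; simp at hd0
    refine ⟨⟨y, b, a⟩, mem_divisorTriples hy0 ?_ hb (by simpa using hc), rfl⟩
    have := Int.one_le_abs hy0
    rw [abs_pow] at hd
    nlinarith
  by_cases hm : 4 * x - 4 * b + a ^ 2 = 0
  · rw [hm, mul_zero, eq_comm, sq_eq_zero_iff] at hprod
    obtain ⟨y, rfl⟩ : (2 : ℤ) ∣ a :=
      Int.prime_two.dvd_of_dvd_pow (n := 2) ⟨2 * b - 2 * x, by linarith⟩
    obtain rfl : x = b - y ^ 2 := by linarith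
    obtain rfl : c = y * (b - y ^ 2) := by linarith
    by_cases hy0 : y = 0
    · right; right; right; right
      subst hy0
      refine ⟨(b, d), ?_, by simp⟩
      simp [← abs_le, hb, hd]
    · right; right; right; left
      refine ⟨⟨y, d, b⟩, mem_divisorTriples hy0 ?_ hd (by rwa [mul_comm]), rfl⟩
      rw [abs_mul, abs_two] at ha
      linarith [abs_nonneg y]
  · obtain ⟨u, v, w, hu, hv, hw, e1, e2, e3⟩ := exists_common_squareclass hn hm hprod
    have hNN : (N : ℤ) ≤ N ^ 2 := by nlinarith
    have d1 : x ^ 2 - u * v ^ 2 = 4 * d := by linarith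
    have d2 : a ^ 2 - u * w ^ 2 = 4 * b - 4 * x := by linarith
    have d3 : a * x - u * v * w = 2 * c := by linarith
    have b1 : |x ^ 2 - u * v ^ 2| ≤ 20 * N := by rw [d1, abs_le] at *; constructor <;> linarith
    have b2 : |a ^ 2 - u * w ^ 2| ≤ 20 * N := by
      rw [d2, abs_le]; rw [abs_le] at hb hxN; constructor <;> linarith
    have b3 : |a * x - u * v * w| ≤ 20 * N := by
      rw [d3, abs_le]; rw [abs_le] at hc; constructor <;> linarith
    have c1 : |u| * v ^ 2 ≤ 36 * N ^ 2 := by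
      have hx2 : x ^ 2 ≤ (4 * N) ^ 2 := sq_le_sq.2 (hxN.trans (le_abs_self _))
      rw [← abs_of_nonneg (sq_nonneg v), ← abs_mul, abs_le]
      rw [abs_le] at b1
      constructor <;> nlinarith [sq_nonneg x]
    have c2 : |u| * w ^ 2 ≤ 36 * N ^ 2 := by
      have ha2 : a ^ 2 ≤ (N : ℤ) ^ 2 := sq_le_sq.2 (ha.trans (le_abs_self _))
      rw [← abs_of_nonneg (sq_nonneg w), ← abs_mul, abs_le]
      rw [abs_le] at b2
      constructor <;> nlinarith [sq_nonneg a]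
    have f1 : (4 * x + a ^ 2 - u * w ^ 2) / 4 = b := by
      rw [show 4 * x + a ^ 2 - u * w ^ 2 = 4 * b by linarith]
      exact Int.mul_ediv_cancel_left _ (by norm_num)
    have f2 : (a * x - u * v * w) / 2 = c := by
      rw [d3]; exact Int.mul_ediv_cancel_left _ (by norm_num)
    have f3 : (x ^ 2 - u * v ^ 2) / 4 = d := by
      rw [d1]; exact Int.mul_ediv_cancel_left _ (by norm_num)
    rcases le_total |w| |v| with hwv | hvw
    · left
      exact ⟨⟨(u, v), w, x, a⟩, mem_hyperbolaTuples hu hv hwv c1 b1 b2 b3, by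
        simp only [f1, f2, f3]⟩
    · right; left
      rw [show a * x - u * v * w = x * a - u * w * v by ring] at b3 f2
      exact ⟨⟨(u, w), v, a, x⟩, mem_hyperbolaTuples hu hw hvw c2 b2 b1 b3, by
        simp only [f1, f2, f3]⟩

theorem finite_reducibleResolventSet {N : ℕ} (hN : 1 ≤ N) : (reducibleResolventSet N).Finite :=
  (resolventCover N).finite_toSet.subset (reducibleResolventSet_subset hN)

theorem ncard_reducibleResolventSet_le {N : ℕ} (hN : 1 ≤ N) :
    ((reducibleResolventSet N).ncard : ℝ) ≤ 60000 * N ^ 2 * absHarmonic (36 * N ^ 2) ^ 2 := by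
  have hN' : (1 : ℝ) ≤ N := by exact_mod_cast hN
  have h1 : (reducibleResolventSet N).ncard ≤ (resolventCover N).card := by
    rw [← Set.ncard_coe_finset]
    exact Set.ncard_le_ncard (reducibleResolventSet_subset hN) (Finset.finite_toSet _)
  have h2 : (resolventCover N).card ≤ (hyperbolaTuples N).card + ((hyperbolaTuples N).card +
      ((divisorTriples N fun _ => 0).card + ((divisorTriples N fun y => y ^ 2).card +
        (Finset.Icc (-(N : ℤ)) N).card * (Finset.Icc (-(N : ℤ)) N).card))) := by
    rw [← Finset.card_product]
    iterate 4
      refine (Finset.card_union_le _ _).trans (add_le_add Finset.card_image_le ?_)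
    exact Finset.card_image_le
  have h3 : ((reducibleResolventSet N).ncard : ℝ) ≤
      (hyperbolaTuples N).card + ((hyperbolaTuples N).card +
      ((divisorTriples N fun _ => 0).card + ((divisorTriples N fun y => y ^ 2).card +
        (Finset.Icc (-(N : ℤ)) N).card * (Finset.Icc (-(N : ℤ)) N).card))) := by
    exact_mod_cast h1.trans h2
  rw [card_Icc_neg] at h3
  have h4 := card_hyperbolaTuples_le N
  have h5 := card_divisorTriples_le hN fun _ => 0
  have h6 := card_divisorTriples_le hN fun y => y ^ 2
  have h7 : absHarmonic N ≤ absHarmonic (36 * N ^ 2) := absHarmonic_mono (by nlinarith)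
  have h8 := two_le_absHarmonic hN
  set T := absHarmonic (36 * N ^ 2)
  have h9 : absHarmonic N ≤ T ^ 2 := by nlinarith
  have h10 : 1 ≤ T ^ 2 := by nlinarith
  have h11 : 9 * (N : ℝ) ^ 2 * absHarmonic N ≤ 9 * N ^ 2 * T ^ 2 := by gcongr
  have h12 : (2 * (N : ℝ) + 1) * (2 * N + 1) ≤ 9 * N ^ 2 * T ^ 2 := by
    have : (2 * (N : ℝ) + 1) * (2 * N + 1) ≤ 9 * N ^ 2 * 1 := by nlinarith
    exact this.trans (by gcongr)
  have h13 : 0 ≤ (N : ℝ) ^ 2 * T ^ 2 := by positivity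
  linarith

theorem quarticGalCount_le (G : Type*) [Group G] (hG : ¬ 3 ∣ Nat.card G) {H : ℝ} (hH : 1 ≤ H) :
    quarticGalCount G H ≤ (reducibleResolventSet ⌊H⌋₊).ncard := by
  have hN : 1 ≤ ⌊H⌋₊ := Nat.one_le_floor_iff _ |>.2 hH
  refine Set.ncard_le_ncard ?_ (finite_reducibleResolventSet hN)
  have habs : ∀ n : ℤ, |(n : ℝ)| ≤ H → |n| ≤ (⌊H⌋₊ : ℤ) := by
    intro n hn
    rw [Int.natCast_floor_eq_floor (by linarith), Int.le_floor]
    exact_mod_cast hn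
  rintro ⟨a, b, c, d⟩ ⟨ha, hb, hc, hd, hirr, ⟨e⟩⟩
  refine ⟨habs _ ha, habs _ hb, habs _ hc, habs _ hd, ?_,
    exists_int_root_resolvent a b c d hirr (by rwa [Nat.card_congr e.toEquiv])⟩
  dsimp only
  rintro rfl
  have hroot := Polynomial.degree_eq_one_of_irreducible_of_root hirr (x := 0) (by simp)
  have h4 : (Polynomial.X ^ 4 + Polynomial.C (a : ℚ) * Polynomial.X ^ 3
      + Polynomial.C (b : ℚ) * Polynomial.X ^ 2 + Polynomial.C (c : ℚ) * Polynomial.X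
      + Polynomial.C ((0 : ℤ) : ℚ)).degree = 4 := by
    compute_degree!
  rw [h4] at hroot
  exact absurd hroot (by decide)

theorem absHarmonic_le_log {H : ℝ} (hH : 2 ≤ H) :
    absHarmonic (36 * ⌊H⌋₊ ^ 2) ≤ 20 * Real.log H := by
  have hN : 1 ≤ ⌊H⌋₊ := Nat.one_le_floor_iff _ |>.2 (by linarith)
  have hN' : (1 : ℝ) ≤ ⌊H⌋₊ := by exact_mod_cast hN
  have hfl : (⌊H⌋₊ : ℝ) ≤ H := Nat.floor_le (by linarith)
  have h2 : 1 ≤ 2 * Real.log H := by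
    have := Real.log_le_log (by norm_num) hH
    linarith [Real.log_two_gt_d9]
  have h1 : Real.log ((36 * ⌊H⌋₊ ^ 2 : ℕ) : ℝ) ≤ 8 * Real.log H := by
    rw [← Real.log_rpow (by linarith) 8]
    apply Real.log_le_log (by positivity)
    have h6 : (2 : ℝ) ^ 6 ≤ H ^ 6 := by gcongr
    push_cast
    calc (36 : ℝ) * ⌊H⌋₊ ^ 2 ≤ H ^ 6 * H ^ 2 := by gcongr; linarith
      _ = H ^ (8 : ℝ) := by rw [← pow_add]; norm_cast
  linarith [absHarmonic_le (36 * ⌊H⌋₊ ^ 2)]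

/-- The number of `D₄`, `V₄` and `C₄` quartics is `O(H² (log H)²)`. -/
theorem D4_V4_C4_upper_bound :
    ∃ K : ℝ, 0 < K ∧ ∀ H : ℝ, 2 ≤ H →
      ((quarticGalCount (DihedralGroup 4) H : ℝ) + (quarticGalCount (Multiplicative (ZMod 2 × ZMod 2)) H : ℝ)
          + (quarticGalCount (Multiplicative (ZMod 4)) H : ℝ))
        ≤ K * H ^ 2 * (Real.log H) ^ 2 := by
  refine ⟨3 * (60000 * 400), by norm_num, fun H hH => ?_⟩
  have hN : 1 ≤ ⌊H⌋₊ := Nat.one_le_floor_iff _ |>.2 (by linarith)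
  have hfl : (⌊H⌋₊ : ℝ) ≤ H := Nat.floor_le (by linarith)
  have hbound : ((reducibleResolventSet ⌊H⌋₊).ncard : ℝ) ≤
      60000 * 400 * H ^ 2 * Real.log H ^ 2 := by
    refine (ncard_reducibleResolventSet_le hN).trans ?_
    have h0 : 0 ≤ absHarmonic (36 * ⌊H⌋₊ ^ 2) :=
      zero_le_two.trans (two_le_absHarmonic (by nlinarith))
    have h1 := absHarmonic_le_log hH
    calc _ ≤ 60000 * H ^ 2 * (20 * Real.log H) ^ 2 := by gcongr
      _ = _ := by ring
  have key : ∀ (G : Type) [Group G], ¬ 3 ∣ Nat.card G →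
      (quarticGalCount G H : ℝ) ≤ 60000 * 400 * H ^ 2 * Real.log H ^ 2 := fun G _ hG =>
    le_trans (by exact_mod_cast quarticGalCount_le G hG (by linarith)) hbound
  have k1 := key (DihedralGroup 4) (by rw [DihedralGroup.nat_card]; norm_num)
  have k2 := key (Multiplicative (ZMod 2 × ZMod 2)) (by simp)
  have k3 := key (Multiplicative (ZMod 4)) (by simp)
  linarith
end

section
/- There exist constants c > 0 and H₀ ≥ 3 such that for all real H ≥ H₀ one has N_{D₄}(H) + N_{V₄}(H) + N_{C₄}(H) ≥ c·H²(log H)². -/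
/-- The action of the dihedral group of order `8` on the vertices of the square. -/
def dihedralFourToPerm : DihedralGroup 4 →* Equiv.Perm (ZMod 4) where
  toFun
    | .r i => Equiv.addRight (-i)
    | .sr i => (Equiv.neg (ZMod 4)).trans (Equiv.addRight i)
  map_one' := by decide
  map_mul' := by decide

theorem dihedralFourToPerm_injective : Function.Injective dihedralFourToPerm := by
  decide

theorem nonempty_mulEquiv_dihedralGroup_four {G α : Type*} [Group G] [Fintype α]
    (hα : Fintype.card α = 4) (f : G →* Equiv.Perm α) (hf : Function.Injective f)
    (hG : Nat.card G = 8) : Nonempty (G ≃* DihedralGroup 4) := by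
  let e : α ≃ ZMod 4 := Fintype.equivOfCardEq (by rw [hα]; rfl)
  let F : G →* Equiv.Perm (ZMod 4) := e.permCongrHom.toMonoidHom.comp f
  have hF : Function.Injective F := e.permCongrHom.injective.comp hf
  have hfac : (Nat.card (Equiv.Perm (ZMod 4))).factorization 2 = 3 := by
    rw [Nat.card_perm, Nat.card_zmod, show Nat.factorial 4 = 2 ^ 3 * 3 from rfl,
      Nat.factorization_mul (by norm_num) (by norm_num), Nat.prime_two.factorization_pow,
      Nat.prime_three.factorization]
    simp
  have h1 : Nat.card F.range = 2 ^ (Nat.card (Equiv.Perm (ZMod 4))).factorization 2 := by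
    rw [hfac, ← Nat.card_congr (MonoidHom.ofInjective hF).toEquiv, hG]; rfl
  have h2 : Nat.card dihedralFourToPerm.range =
      2 ^ (Nat.card (Equiv.Perm (ZMod 4))).factorization 2 := by
    rw [hfac, ← Nat.card_congr (MonoidHom.ofInjective dihedralFourToPerm_injective).toEquiv,
      DihedralGroup.nat_card]; rfl
  have E := Sylow.equiv (Sylow.ofCard F.range h1) (Sylow.ofCard dihedralFourToPerm.range h2)
  exact ⟨(MonoidHom.ofInjective hF).trans
    (E.trans (MonoidHom.ofInjective dihedralFourToPerm_injective).symm)⟩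

theorem nonempty_mulEquiv_of_card_eq_four {G : Type*} [Group G] (hG : Nat.card G = 4) :
    Nonempty (G ≃* Multiplicative (ZMod 2 × ZMod 2)) ∨ Nonempty (G ≃* Multiplicative (ZMod 4)) := by
  have : Finite G := Nat.finite_of_card_ne_zero (by omega)
  by_cases hc : IsCyclic G
  · exact Or.inr ⟨mulEquivOfCyclicCardEq (by simp [hG])⟩
  · have hsq : ∀ g : G, g ^ 2 = 1 := by
      intro g
      have hd : orderOf g ∣ 2 ^ 2 := by simpa [hG] using orderOf_dvd_natCard g
      obtain ⟨k, hk, hk'⟩ := (Nat.dvd_prime_pow Nat.prime_two).1 hd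
      have hne : k ≠ 2 := by
        rintro rfl
        exact hc (isCyclic_of_orderOf_eq_card g (by rw [hk', hG]; rfl))
      have : orderOf g ∣ 2 := by
        rw [hk']; exact pow_dvd_pow 2 (show k ≤ 1 by omega)
      exact orderOf_dvd_iff_pow_eq_one.1 this
    have : Nontrivial G := Finite.one_lt_card_iff_nontrivial.1 (by omega)
    have : IsKleinFour G :=
      { card_four := hG
        exponent_two := by
          refine ((Nat.dvd_prime Nat.prime_two).1
            (Monoid.exponent_dvd_of_forall_pow_eq_one hsq)).resolve_left ?_
          rw [Monoid.exp_eq_one_iff]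
          exact not_subsingleton G }
    exact Or.inl IsKleinFour.nonempty_mulEquiv

open Polynomial in
theorem Polynomial.natDegree_dvd_card_gal {F : Type*} [Field F] [CharZero F] {f : F[X]}
    (hf : Irreducible f) : f.natDegree ∣ Nat.card f.Gal := by
  rw [Gal.card_of_separable hf.separable]
  have hdeg : (f.map (algebraMap F f.SplittingField)).degree ≠ 0 := by
    rw [degree_map]
    exact hf.degree_pos.ne'
  let α : f.SplittingField := rootOfSplits (SplittingField.splits f) hdeg
  have hα : aeval α f = 0 := by
    rw [aeval_def, ← eval_map]
    exact eval_rootOfSplits (SplittingField.splits f) hdeg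
  have hαint : IsIntegral F α := .of_finite F α
  have hmin : (minpoly F α).natDegree = f.natDegree :=
    natDegree_eq_of_degree_eq <| degree_eq_degree_of_associated <|
      (minpoly.irreducible hαint).associated_of_dvd hf (minpoly.dvd F α hα)
  rw [← hmin, ← IntermediateField.adjoin.finrank hαint]
  exact ⟨_, (Module.finrank_mul_finrank F (IntermediateField.adjoin F {α}) f.SplittingField).symm⟩

open Polynomial in
theorem not_three_dvd_card_gal {f : ℚ[X]} {D p q r s : ℚ} (hs : s ≠ 0)
    (hf : f = (X ^ 2 + C p * X + C q) ^ 2 - C D * (C r * X + C s) ^ 2)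
    (hdeg : f.natDegree = 4) (hirr : Irreducible f) : ¬ 3 ∣ Nat.card f.Gal := by
  intro h3
  have : Finite f.Gal := inferInstance
  have : Fact (Nat.Prime 3) := ⟨Nat.prime_three⟩
  obtain ⟨g, hg⟩ := exists_prime_orderOf_dvd_card' 3 h3
  have hg3 : g ^ 3 = 1 := by rw [← hg, pow_orderOf_eq_one]
  have hggg : ∀ x, g (g (g x)) = x := fun x =>
    DFunLike.congr_fun (hg3 : g * (g * g) = 1) x
  have fix : ∀ w : f.SplittingField, g (w ^ 2) = w ^ 2 → g w = w := by
    intro w hw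
    rw [map_pow, sq_eq_sq_iff_eq_or_eq_neg] at hw
    rcases hw with hw | hw
    · exact hw
    · have := hggg w
      rw [hw, map_neg, hw, neg_neg, hw] at this
      rw [hw, this]
  have hrat : ∀ c : ℚ, g (c : f.SplittingField) = c := fun c => map_ratCast g c
  have hB : ∀ α : f.SplittingField, aeval α f = 0 → (r * α + s : f.SplittingField) ≠ 0 := by
    intro α hα h0
    have hd : f ∣ C r * X + C s := by
      have h1 : minpoly ℚ α ∣ C r * X + C s := minpoly.dvd _ _ (by simpa using h0)
      have h2 := (minpoly.irreducible (IsIntegral.of_finite ℚ α)).associated_of_dvd hirr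
        (minpoly.dvd ℚ α hα)
      exact h2.symm.dvd.trans h1
    have hne : C r * X + C s ≠ 0 := by
      intro h
      have := congrArg (fun P => coeff P 0) h
      simp at this
      exact hs this
    have := natDegree_le_of_dvd hd hne
    have := natDegree_linear_le (a := r) (b := s)
    omega
  have hroot : ∀ α : f.SplittingField, aeval α f = 0 →
      (α ^ 2 + p * α + q) ^ 2 = D * (r * α + s) ^ 2 := by
    intro α hα
    have h : aeval α ((X ^ 2 + C p * X + C q) ^ 2 - C D * (C r * X + C s) ^ 2) = 0 := hf ▸ hα
    simp at h
    linear_combination h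
  have key : ∀ α : f.SplittingField, aeval α f = 0 → g α = α := by
    intro α hα
    obtain ⟨w, hw⟩ : ∃ w, w = (α ^ 2 + p * α + q) / (r * α + s) := ⟨_, rfl⟩
    have hb := hB α hα
    have hA : α ^ 2 + p * α + q = w * (r * α + s) := by
      rw [hw, div_mul_cancel₀ _ hb]
    have hw2 : w ^ 2 = D := by
      have := hroot α hα
      rw [hA, mul_pow] at this
      exact mul_right_cancel₀ (pow_ne_zero 2 hb) this
    have hgw : g w = w := fix w (by rw [hw2, hrat])
    have h1 : g (2 * α + p - w * r) = 2 * α + p - w * r := by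
      refine fix _ ?_
      have : (2 * α + p - w * r) ^ 2 = (p - w * r) ^ 2 - 4 * (q - w * s) := by
        linear_combination 4 * hA
      rw [this]
      simp only [map_sub, map_mul, map_pow, hrat, hgw, map_ofNat]
    simp only [map_sub, map_mul, map_add, hrat, hgw, map_ofNat] at h1
    linear_combination h1 / 2
  have : g = 1 := Gal.ext f fun x hx => by
    rw [mem_rootSet] at hx
    exact key x hx.2
  rw [this] at hg
  simp at hg

open Polynomial in
theorem gal_card_eq_four_or_eight {f : ℚ[X]} {D p q r s : ℚ} (hs : s ≠ 0)
    (hf : f = (X ^ 2 + C p * X + C q) ^ 2 - C D * (C r * X + C s) ^ 2)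
    (hdeg : f.natDegree = 4) (hirr : Irreducible f) :
    Nat.card f.Gal = 4 ∨ Nat.card f.Gal = 8 := by
  have h3 := not_three_dvd_card_gal hs hf hdeg hirr
  have h4 := natDegree_dvd_card_gal hirr
  have hroots : Nat.card (f.rootSet f.SplittingField) = 4 := by
    rw [← hdeg, ← card_rootSet_eq_natDegree hirr.separable (SplittingField.splits f),
      Nat.card_eq_fintype_card]
    exact Fintype.card_congr (Equiv.refl _)
  have : Fact ((f.map (algebraMap ℚ f.SplittingField)).Splits) := ⟨SplittingField.splits f⟩
  have h24 : Nat.card f.Gal ∣ 24 := by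
    have := Subgroup.card_dvd_of_injective _ (Gal.galActionHom_injective f f.SplittingField)
    rwa [Nat.card_perm, hroots] at this
  rw [hdeg] at h4
  have := Nat.le_of_dvd (by norm_num) h24
  generalize Nat.card f.Gal = n at *
  interval_cases n <;> omega

theorem Nat.eq_of_mul_sq_eq_mul_sq {a b m n : ℕ} (ha : Squarefree a) (hb : Squarefree b)
    (hm : m ≠ 0) (h : a * m ^ 2 = b * n ^ 2) : a = b := by
  have dvd : ∀ {a b m n : ℕ}, Squarefree a → Squarefree b → m ≠ 0 → a * m ^ 2 = b * n ^ 2 →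
      a ∣ b := by
    intro a b m n ha hb hm h
    have h1 : a * b * m ^ 2 = (b * n) ^ 2 := by linear_combination b * h
    obtain ⟨k, hk⟩ : m ∣ b * n := (Nat.pow_dvd_pow_iff two_ne_zero).1 ⟨a * b, by rw [← h1]; ring⟩
    have h2 : a * b = k ^ 2 := by
      refine mul_right_cancel₀ (pow_ne_zero 2 hm) ?_
      rw [h1, hk]; ring
    obtain ⟨l, rfl⟩ : a ∣ k := (ha.dvd_pow_iff_dvd two_ne_zero).1 ⟨b, h2.symm⟩
    exact ⟨l ^ 2, mul_left_cancel₀ ha.ne_zero (by rw [h2]; ring)⟩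
  have hn : n ≠ 0 := by
    rintro rfl
    simp [ha.ne_zero, hm] at h
  exact Nat.dvd_antisymm (dvd ha hb hm h) (dvd hb ha hn h.symm)

theorem log_sub_log_le_sum_inv {a b : ℕ} (ha : 0 < a) (hab : a ≤ b) :
    Real.log b - Real.log a ≤ ∑ k ∈ Finset.Ico a b, (k : ℝ)⁻¹ := by
  induction b, hab using Nat.le_induction with
  | base => simp
  | succ b hab ih =>
    rw [Finset.sum_Ico_succ_top hab]
    have hb : (0 : ℝ) < b := by exact_mod_cast ha.trans_le hab
    have h : Real.log ((b + 1) / b) ≤ (b + 1) / b - 1 :=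
      Real.log_le_sub_one_of_pos (by positivity)
    rw [Real.log_div (by positivity) hb.ne'] at h
    have h2 : ((b : ℝ) + 1) / b - 1 = (b : ℝ)⁻¹ := by field_simp; ring
    push_cast
    linarith

open Finset in
theorem sum_inv_odd_squarefree_lower_bound (N : ℕ) :
    Real.log (N + 1) ≤ 4 * ∑ e ∈ (range (2 * N)).filter (fun e => Odd e ∧ Squarefree e),
      (e : ℝ)⁻¹ := by
  have h1 : Real.log (N + 1) ≤ 2 * ∑ k ∈ range N, ((2 * k + 1 : ℕ) : ℝ)⁻¹ := by
    have h := log_sub_log_le_sum_inv (a := 1) (b := N + 1) one_pos (by omega)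
    rw [Nat.cast_one, Real.log_one, sub_zero, Finset.sum_Ico_eq_sum_range] at h
    push_cast at h
    refine h.trans ?_
    rw [mul_sum]
    refine sum_le_sum fun k _ => ?_
    push_cast
    rw [inv_le_comm₀ (by positivity) (by positivity), mul_inv, inv_inv]
    linarith
  have h2 : ∑ k ∈ range N, ((2 * k + 1 : ℕ) : ℝ)⁻¹ ≤
      ∑ x ∈ (range (2 * N)).filter (fun e => Odd e ∧ Squarefree e) ×ˢ Ioo 0 (2 * N),
        (x.1 : ℝ)⁻¹ * ((x.2 : ℝ) ^ 2)⁻¹ := by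
    have hex : ∀ k : ℕ, ∃ x : ℕ × ℕ, x.2 ^ 2 * x.1 = 2 * k + 1 ∧ Squarefree x.1 := fun k => by
      obtain ⟨a, b, h, hs⟩ := Nat.sq_mul_squarefree (2 * k + 1)
      exact ⟨(a, b), h, hs⟩
    choose g hg hsq using hex
    have hinj : Set.InjOn g (range N) := by
      intro k _ l _ hkl
      have h := hg k
      rw [hkl, hg l] at h
      omega
    calc ∑ k ∈ range N, ((2 * k + 1 : ℕ) : ℝ)⁻¹
        = ∑ k ∈ range N, ((g k).1 : ℝ)⁻¹ * (((g k).2 : ℝ) ^ 2)⁻¹ := by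
          refine sum_congr rfl fun k _ => ?_
          rw [← hg k, ← mul_inv]
          push_cast
          rw [mul_comm]
      _ = ∑ x ∈ (range N).image g, (x.1 : ℝ)⁻¹ * ((x.2 : ℝ) ^ 2)⁻¹ :=
          (sum_image (f := fun x : ℕ × ℕ => (x.1 : ℝ)⁻¹ * ((x.2 : ℝ) ^ 2)⁻¹) hinj).symm
      _ ≤ _ := by
          refine sum_le_sum_of_subset_of_nonneg ?_ fun _ _ _ => by positivity
          intro x hx
          obtain ⟨k, hk, rfl⟩ := mem_image.1 hx
          rw [mem_range] at hk
          have hodd : Odd ((g k).2 ^ 2 * (g k).1) := by rw [hg k]; exact odd_two_mul_add_one k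
          have hpos : 0 < (g k).2 := Nat.pos_of_ne_zero fun h0 => by
            have := hg k
            simp [h0] at this
          have hle1 : (g k).1 ≤ 2 * k + 1 := Nat.le_of_dvd (by omega) ⟨_, by rw [← hg k, mul_comm]⟩
          have hle2 : (g k).2 ≤ 2 * k + 1 := Nat.le_of_dvd (by omega)
            ⟨(g k).2 * (g k).1, by rw [← hg k]; ring⟩
          simp only [mem_product, mem_filter, mem_range, mem_Ioo]
          exact ⟨⟨by omega, (Nat.odd_mul.1 hodd).2, hsq k⟩, hpos, by omega⟩
  rw [sum_product] at h2
  simp_rw [← mul_sum, ← sum_mul] at h2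
  have h3 : ∑ i ∈ Ioo 0 (2 * N), ((i : ℝ) ^ 2)⁻¹ ≤ 2 := by
    simpa using sum_Ioo_inv_sq_le (α := ℝ) 0 (2 * N)
  have h4 : (0 : ℝ) ≤ ∑ e ∈ (range (2 * N)).filter (fun e => Odd e ∧ Squarefree e), (e : ℝ)⁻¹ :=
    sum_nonneg fun _ _ => by positivity
  have h5 := mul_le_mul_of_nonneg_left h3 h4
  linarith

open Polynomial in
theorem irreducible_quartic_of_eisenstein_two {a b c d : ℤ} (ha : 2 ∣ a) (hb : 2 ∣ b) (hc : 2 ∣ c)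
    (hd : 2 ∣ d) (hd' : ¬ 4 ∣ d) :
    Irreducible (X ^ 4 + C (a : ℚ) * X ^ 3 + C (b : ℚ) * X ^ 2 + C (c : ℚ) * X + C (d : ℚ)) := by
  have hE : (X ^ 4 + C a * X ^ 3 + C b * X ^ 2 + C c * X + C d : ℤ[X]).IsEisensteinAt
      (Ideal.span {2}) := by
    have hnat : (X ^ 4 + C a * X ^ 3 + C b * X ^ 2 + C c * X + C d : ℤ[X]).natDegree = 4 := by
      compute_degree!
    refine ⟨?_, ?_, ?_⟩
    · rw [Monic.leadingCoeff (by monicity!), Ideal.mem_span_singleton]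
      norm_num
    · intro k hk
      rw [hnat] at hk
      rw [Ideal.mem_span_singleton]
      interval_cases k <;> simp only [coeff_add, coeff_X_pow, coeff_C_mul, coeff_X, coeff_C] <;>
        norm_num <;> assumption
    · rw [Ideal.span_singleton_pow, Ideal.mem_span_singleton]
      simpa using hd'
  have hmon : (X ^ 4 + C a * X ^ 3 + C b * X ^ 2 + C c * X + C d : ℤ[X]).Monic := by monicity!
  have h := hE.irreducible ((Ideal.span_singleton_prime two_ne_zero).2 Int.prime_two)
    hmon.isPrimitive (by
      have : (X ^ 4 + C a * X ^ 3 + C b * X ^ 2 + C c * X + C d : ℤ[X]).natDegree = 4 := by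
        compute_degree!
      omega)
  simpa using (IsPrimitive.Int.irreducible_iff_irreducible_map_cast hmon.isPrimitive).1 h

/-- The non-leading coefficients of the quartic `(X² + pX + q)² - D (rX + s)²`. -/
def normQuartic (D p q r s : ℤ) : ℤ × ℤ × ℤ × ℤ :=
  (2 * p, p ^ 2 + 2 * q - D * r ^ 2, 2 * (p * q - D * r * s), q ^ 2 - D * s ^ 2)

open Polynomial in
theorem card_filter_normQuartic_le {ι : Type*} (S : Finset ι) (e : ι → ℕ)
    (p q r s : ι → ℤ) (he : ∀ x ∈ S, Squarefree (e x)) (hs : ∀ x ∈ S, 0 < s x)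
    (hinj : ∀ x ∈ S, ∀ y ∈ S, e x = e y → p x = p y → q x = q y → r x = r y → s x = s y → x = y)
    (v : ℤ × ℤ × ℤ × ℤ) :
    (S.filter fun x => normQuartic (2 * e x) (p x) (q x) (r x) (s x) = v).card ≤ 3 := by
  obtain ⟨a, b, c, d⟩ := v
  let P : ℤ[X] := C 8 * X ^ 3 + C (-4 * b) * X ^ 2 + C (2 * a * c - 8 * d) * X
    + C (-(a ^ 2 - 4 * b) * d - c ^ 2)
  have hP : P.natDegree = 3 := natDegree_cubic (by norm_num)
  have hP0 : P ≠ 0 := by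
    intro h
    simp [h] at hP
  rw [← hP]
  refine le_trans ?_ ((Multiset.toFinset_card_le _).trans (card_roots' P))
  refine Finset.card_le_card_of_injOn q ?_ ?_
  · intro x hx
    simp only [normQuartic, Finset.coe_filter, Set.mem_ofPred_eq, Prod.mk.injEq] at hx
    obtain ⟨-, rfl, rfl, rfl, rfl⟩ := hx
    simp only [P, Finset.mem_coe, Multiset.mem_toFinset, mem_roots hP0, IsRoot.def]
    simp
    ring
  · intro x hx y hy hxy
    simp only [normQuartic, Finset.coe_filter, Set.mem_ofPred_eq, Prod.mk.injEq] at hx hy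
    obtain ⟨hxS, hx1, hx2, hx3, hx4⟩ := hx
    obtain ⟨hyS, hy1, hy2, hy3, hy4⟩ := hy
    have hp : p x = p y := by omega
    have hsx := hs x hxS
    have hsy := hs y hyS
    have h1 : (e x : ℤ) * (s x) ^ 2 = e y * (s y) ^ 2 := by
      rw [hxy] at hx4
      linarith
    have hee : e x = e y := by
      refine Nat.eq_of_mul_sq_eq_mul_sq (m := (s x).natAbs) (n := (s y).natAbs) (he x hxS)
        (he y hyS) (by omega) ?_
      zify
      simpa only [sq_abs] using h1
    have he0 : (e y : ℤ) ≠ 0 := by exact_mod_cast (he y hyS).ne_zero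
    have hss : s x = s y := by
      rw [hee] at h1
      have := mul_left_cancel₀ he0 h1
      exact (sq_eq_sq₀ hsx.le hsy.le).1 this
    refine hinj x hxS y hyS hee hp hxy ?_ hss
    rw [hee, hp, hxy, hss, ← hy3] at hx3
    have h2 : (4 * (e y : ℤ) * s y) * r x = (4 * e y * s y) * r y := by linear_combination -hx3
    exact mul_left_cancel₀ (by positivity) h2

open Polynomial in
theorem gal_normQuartic {D p q r s : ℤ} (hs : s ≠ 0) {a b c d : ℤ}
    (h : normQuartic D p q r s = (a, b, c, d)) {f : ℚ[X]}
    (hf : f = X ^ 4 + C (a : ℚ) * X ^ 3 + C (b : ℚ) * X ^ 2 + C (c : ℚ) * X + C (d : ℚ))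
    (hirr : Irreducible f) :
    Nonempty (f.Gal ≃* DihedralGroup 4) ∨ Nonempty (f.Gal ≃* Multiplicative (ZMod 2 × ZMod 2)) ∨
      Nonempty (f.Gal ≃* Multiplicative (ZMod 4)) := by
  have hdeg : f.natDegree = 4 := by
    rw [hf]
    compute_degree!
  have hf' : f = (X ^ 2 + C (p : ℚ) * X + C (q : ℚ)) ^ 2
      - C (D : ℚ) * (C (r : ℚ) * X + C (s : ℚ)) ^ 2 := by
    simp only [normQuartic, Prod.mk.injEq] at h
    obtain ⟨rfl, rfl, rfl, rfl⟩ := h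
    rw [hf]
    push_cast
    simp only [C_add, C_sub, C_mul, C_pow, map_ofNat]
    ring
  rcases gal_card_eq_four_or_eight (Int.cast_ne_zero.2 hs) hf' hdeg hirr with h4 | h8
  · exact Or.inr (nonempty_mulEquiv_of_card_eq_four h4)
  · have : Fact ((f.map (algebraMap ℚ f.SplittingField)).Splits) := ⟨SplittingField.splits f⟩
    refine Or.inl (nonempty_mulEquiv_dihedralGroup_four ?_
      (Gal.galActionHom f f.SplittingField) (Gal.galActionHom_injective f f.SplittingField) h8)
    rw [← hdeg, ← card_rootSet_eq_natDegree hirr.separable (SplittingField.splits f)]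
    exact Fintype.card_congr (Equiv.refl _)

theorem abs_coeff_le_of_near {h x y θ φ η : ℝ} (hx : 0 < x) (hxy : x ≤ y) (hyx : y ≤ 2 * x)
    (hhx : h ≤ x ^ 2) (hxh : 64 * x ≤ h) (hη : η * x = h / 8) (hθ : 0 ≤ θ) (hθη : θ ≤ η)
    (hφ : 0 ≤ φ) (hφη : φ ≤ η) :
    |2 * (x + θ)| ≤ h ∧ |(x + θ) ^ 2 + 2 * (y + φ) - x ^ 2| ≤ h ∧
      |2 * ((x + θ) * (y + φ) - x * y)| ≤ h ∧ |(y + φ) ^ 2 - y ^ 2| ≤ h := by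
  have hηx : η ≤ x / 8 := by
    refine le_of_mul_le_mul_right ?_ hx
    rw [hη]; nlinarith
  have hη0 : 0 ≤ η := hθ.trans hθη
  have hη2 : η * η ≤ h / 64 := by nlinarith
  have h1 : θ * x ≤ h / 8 := by rw [← hη]; gcongr
  have h2 : φ * x ≤ h / 8 := by rw [← hη]; gcongr
  have h3 : θ * y ≤ h / 4 := by nlinarith
  have h4 : φ * y ≤ h / 4 := by nlinarith
  have h5 : θ * θ ≤ h / 64 := (mul_le_mul hθη hθη hθ hη0).trans hη2
  have h6 : θ * φ ≤ h / 64 := (mul_le_mul hθη hφη hφ hη0).trans hη2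
  have h7 : φ * φ ≤ h / 64 := (mul_le_mul hφη hφη hφ hη0).trans hη2
  have hy : 0 < y := hx.trans_le hxy
  have k1 : 0 ≤ θ * x := by positivity
  have k2 : 0 ≤ φ * x := by positivity
  have k3 : 0 ≤ θ * y := by positivity
  have k4 : 0 ≤ φ * y := by positivity
  have k5 : 0 ≤ θ * θ := by positivity
  have k6 : 0 ≤ θ * φ := by positivity
  have k7 : 0 ≤ φ * φ := by positivity
  refine ⟨?_, ?_, ?_, ?_⟩ <;> rw [abs_le] <;> constructor <;> linarith

/-- The `i`-th even integer that is at least `x`. -/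
noncomputable def evenAbove (x : ℝ) (i : ℕ) : ℤ := 2 * (⌈x / 2⌉ + i)

theorem even_evenAbove (x : ℝ) (i : ℕ) : 2 ∣ evenAbove x i := ⟨_, rfl⟩

theorem evenAbove_injective (x : ℝ) : Function.Injective (evenAbove x) := by
  intro i j h
  simp only [evenAbove] at h
  omega

theorem evenAbove_mem_Icc {x η : ℝ} {i : ℕ} (hi : i < ⌊η / 2⌋₊) :
    (evenAbove x i : ℝ) ∈ Set.Icc x (x + η) := by
  have hη : ((i + 1 : ℕ) : ℝ) ≤ η / 2 := (Nat.le_floor_iff' (by omega)).1 (by omega)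
  have h1 := Int.le_ceil (x / 2)
  have h2 := Int.ceil_lt_add_one (x / 2)
  simp only [evenAbove, Set.mem_Icc]
  push_cast at hη ⊢
  constructor <;> linarith [(Nat.cast_nonneg i : (0 : ℝ) ≤ i)]

/-- The number of even integers taken above `r√D` and above `s√D` at height `n ^ 8`, for `D = 2e`
and `r = 2ρ`, where `x = (e, ρ)`. -/
noncomputable def windowCard (n : ℕ) (x : ℕ × ℕ) : ℕ :=
  ⌊(n : ℝ) ^ 8 / (8 * (2 * x.2 * √(2 * x.1))) / 2⌋₊

open Finset in
/-- The parameters `⟨(e, ρ), (t, i, j)⟩` of the family of quartics of height at most `n ^ 8`. -/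
noncomputable def paramSet (n : ℕ) : Finset (Σ _ : ℕ × ℕ, ℕ × ℕ × ℕ) :=
  ((range (2 * n)).filter (fun e => Odd e ∧ Squarefree e) ×ˢ Ico (n ^ 4) (n ^ 6)).sigma
    fun x => range x.2 ×ˢ range (windowCard n x) ×ˢ range (windowCard n x)

/-- The coefficients of `(X² + pX + q)² - D (rX + s)²` with `D = 2e`, `r = 2ρ`, `s = 2ρ + 2t + 1`,
and `p`, `q` the `i`-th and `j`-th even integers above `r√D` and `s√D`. -/
noncomputable def paramCoeff (z : Σ _ : ℕ × ℕ, ℕ × ℕ × ℕ) : ℤ × ℤ × ℤ × ℤ :=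
  normQuartic (2 * z.1.1) (evenAbove (2 * z.1.2 * √(2 * z.1.1)) z.2.2.1)
    (evenAbove ((2 * z.1.2 + 2 * z.2.1 + 1) * √(2 * z.1.1)) z.2.2.2)
    (2 * z.1.2) (2 * z.1.2 + 2 * z.2.1 + 1)

theorem mem_paramSet {n e ρ t i j : ℕ} :
    (⟨(e, ρ), (t, i, j)⟩ : Σ _ : ℕ × ℕ, ℕ × ℕ × ℕ) ∈ paramSet n ↔
      ((e < 2 * n ∧ Odd e ∧ Squarefree e) ∧ n ^ 4 ≤ ρ ∧ ρ < n ^ 6) ∧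
        t < ρ ∧ i < windowCard n (e, ρ) ∧ j < windowCard n (e, ρ) := by
  simp [paramSet]

theorem scale_bounds {n e ρ : ℕ} (hn : 200 ≤ n) (he : e < 2 * n) (he0 : 0 < e)
    (hρ : n ^ 4 ≤ ρ) (hρ' : ρ < n ^ 6) :
    0 < 2 * (ρ : ℝ) * √(2 * e) ∧ (n : ℝ) ^ 8 ≤ (2 * ρ * √(2 * e)) ^ 2 ∧
      64 * (2 * ρ * √(2 * e)) ≤ (n : ℝ) ^ 8 := by
  have hnR : (200 : ℝ) ≤ n := by exact_mod_cast hn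
  have heR : (1 : ℝ) ≤ e := by exact_mod_cast he0
  have heR' : (e : ℝ) ≤ 2 * n := by exact_mod_cast he.le
  have hρR : (n : ℝ) ^ 4 ≤ ρ := by exact_mod_cast hρ
  have hρR' : (ρ : ℝ) ≤ (n : ℝ) ^ 6 := by exact_mod_cast hρ'.le
  have hρ0 : (0 : ℝ) < ρ := lt_of_lt_of_le (by positivity) hρR
  have hsq : (2 * (ρ : ℝ) * √(2 * e)) ^ 2 = 8 * e * (ρ : ℝ) ^ 2 := by
    rw [mul_pow, Real.sq_sqrt (by positivity)]; ring
  refine ⟨by positivity, ?_, ?_⟩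
  · rw [hsq]
    calc (n : ℝ) ^ 8 = 1 * 1 * ((n : ℝ) ^ 4) ^ 2 := by ring
      _ ≤ 8 * e * (ρ : ℝ) ^ 2 := by gcongr; norm_num
  · refine le_of_sq_le_sq ?_ (by positivity)
    rw [mul_pow, hsq]
    calc (64 : ℝ) ^ 2 * (8 * e * (ρ : ℝ) ^ 2) ≤ 64 ^ 2 * (8 * (2 * n) * ((n : ℝ) ^ 6) ^ 2) := by
          gcongr
      _ = 65536 * (n : ℝ) ^ 13 := by ring
      _ ≤ (n : ℝ) ^ 3 * (n : ℝ) ^ 13 := by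
          gcongr
          calc (65536 : ℝ) ≤ 200 ^ 3 := by norm_num
            _ ≤ _ := by gcongr
      _ = ((n : ℝ) ^ 8) ^ 2 := by ring

theorem abs_paramCoeff_le {n : ℕ} (hn : 200 ≤ n) {z : Σ _ : ℕ × ℕ, ℕ × ℕ × ℕ}
    (hz : z ∈ paramSet n) :
    |((paramCoeff z).1 : ℝ)| ≤ (n : ℝ) ^ 8 ∧ |((paramCoeff z).2.1 : ℝ)| ≤ (n : ℝ) ^ 8 ∧
      |((paramCoeff z).2.2.1 : ℝ)| ≤ (n : ℝ) ^ 8 ∧ |((paramCoeff z).2.2.2 : ℝ)| ≤ (n : ℝ) ^ 8 := by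
  obtain ⟨⟨e, ρ⟩, t, i, j⟩ := z
  obtain ⟨⟨⟨he, heo, -⟩, hρ, hρ'⟩, ht, hi, hj⟩ := mem_paramSet.1 hz
  obtain ⟨hx0, hx1, hx2⟩ := scale_bounds hn he heo.pos hρ hρ'
  have hD : √(2 * (e : ℝ)) ^ 2 = 2 * e := Real.sq_sqrt (by positivity)
  have hxy : 2 * (ρ : ℝ) * √(2 * e) ≤ (2 * ρ + 2 * t + 1) * √(2 * e) := by
    gcongr
    linarith [(Nat.cast_nonneg t : (0 : ℝ) ≤ t)]
  have hyx : (2 * (ρ : ℝ) + 2 * t + 1) * √(2 * e) ≤ 2 * (2 * (ρ : ℝ) * √(2 * e)) := by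
    rw [← mul_assoc]
    gcongr
    have : (t : ℝ) + 1 ≤ ρ := by exact_mod_cast ht
    linarith
  have hη : (n : ℝ) ^ 8 / (8 * (2 * ρ * √(2 * e))) * (2 * ρ * √(2 * e)) = (n : ℝ) ^ 8 / 8 := by
    rw [mul_comm 8, ← div_div, div_right_comm, div_mul_cancel₀ _ hx0.ne']
  obtain ⟨hp1, hp2⟩ := evenAbove_mem_Icc (x := 2 * (ρ : ℝ) * √(2 * e)) hi
  obtain ⟨hq1, hq2⟩ := evenAbove_mem_Icc (x := (2 * (ρ : ℝ) + 2 * t + 1) * √(2 * e)) hj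
  obtain ⟨h1, h2, h3, h4⟩ := abs_coeff_le_of_near hx0 hxy hyx hx1 hx2 hη
    (sub_nonneg.2 hp1) (sub_le_iff_le_add'.2 hp2) (sub_nonneg.2 hq1) (sub_le_iff_le_add'.2 hq2)
  rw [add_sub_cancel] at h1 h2 h3
  rw [add_sub_cancel] at h2 h3 h4
  rw [mul_pow, hD] at h2
  rw [mul_pow, hD] at h4
  rw [show 2 * (ρ : ℝ) * √(2 * e) * ((2 * ρ + 2 * t + 1) * √(2 * e)) =
    √(2 * (e : ℝ)) ^ 2 * (2 * ρ) * (2 * ρ + 2 * t + 1) by ring, hD] at h3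
  simp only [paramCoeff, normQuartic]
  push_cast
  refine ⟨h1, ?_, h3, ?_⟩
  · convert h2 using 2; ring
  · convert h4 using 2; ring

open Polynomial in
theorem irreducible_of_normQuartic {e p q r s a b c d : ℤ} (he : Odd e) (hp : 2 ∣ p) (hq : 2 ∣ q)
    (hs : Odd s) (h : normQuartic (2 * e) p q r s = (a, b, c, d)) :
    Irreducible (X ^ 4 + C (a : ℚ) * X ^ 3 + C (b : ℚ) * X ^ 2 + C (c : ℚ) * X + C (d : ℚ)) := by
  obtain ⟨k, rfl⟩ := he
  obtain ⟨p, rfl⟩ := hp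
  obtain ⟨q, rfl⟩ := hq
  obtain ⟨m, rfl⟩ := hs
  simp only [normQuartic, Prod.mk.injEq] at h
  obtain ⟨ha, hb, hc, hd⟩ := h
  have hd' : d = 4 * (q ^ 2 - k * (2 * m + 1) ^ 2 - 2 * m ^ 2 - 2 * m - 1) + 2 := by
    rw [← hd]; ring
  exact irreducible_quartic_of_eisenstein_two ⟨_, ha.symm⟩
    ⟨2 * p ^ 2 + 2 * q - (2 * k + 1) * r ^ 2, by rw [← hb]; ring⟩ ⟨_, hc.symm⟩
    (by omega) (by omega)

open Polynomial in
theorem irreducible_paramCoeff {n : ℕ} {z : Σ _ : ℕ × ℕ, ℕ × ℕ × ℕ} (hz : z ∈ paramSet n) :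
    Irreducible (X ^ 4 + C ((paramCoeff z).1 : ℚ) * X ^ 3 + C ((paramCoeff z).2.1 : ℚ) * X ^ 2
      + C ((paramCoeff z).2.2.1 : ℚ) * X + C ((paramCoeff z).2.2.2 : ℚ)) := by
  obtain ⟨⟨e, ρ⟩, t, i, j⟩ := z
  have he : Odd e := (mem_paramSet.1 hz).1.1.2.1
  have hs : Odd (2 * (ρ : ℤ) + 2 * t + 1) := ⟨ρ + t, by ring⟩
  exact irreducible_of_normQuartic (he.natCast (R := ℤ)) (even_evenAbove _ _) (even_evenAbove _ _)
    hs rfl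

theorem card_filter_paramCoeff_le (n : ℕ) (v : ℤ × ℤ × ℤ × ℤ) :
    ((paramSet n).filter fun z => paramCoeff z = v).card ≤ 3 := by
  refine card_filter_normQuartic_le (paramSet n) (fun z => z.1.1) _ _ _ _ ?_ ?_ ?_ v
  · rintro ⟨⟨e, ρ⟩, t, i, j⟩ hz
    exact (mem_paramSet.1 hz).1.1.2.2
  · rintro ⟨⟨e, ρ⟩, t, i, j⟩ -
    positivity
  · rintro ⟨⟨e, ρ⟩, t, i, j⟩ - ⟨⟨e', ρ'⟩, t', i', j'⟩ - he hp hq hr hs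
    simp only at he hp hq hr hs
    obtain rfl := he
    obtain rfl : ρ = ρ' := by omega
    obtain rfl : t = t' := by omega
    obtain rfl := evenAbove_injective _ hp
    obtain rfl := evenAbove_injective _ hq
    rfl

open Finset in
theorem card_paramSet_lower_bound {n : ℕ} (hn : 200 ≤ n) :
    ((n : ℝ) ^ 8) ^ 2 * Real.log n ^ 2 ≤ 16384 * ((paramSet n).card : ℝ) := by
  have hterm : ∀ x ∈ (range (2 * n)).filter (fun e => Odd e ∧ Squarefree e) ×ˢ Ico (n ^ 4) (n ^ 6),
      ((n : ℝ) ^ 8) ^ 2 * ((x.1 : ℝ)⁻¹ * (x.2 : ℝ)⁻¹) ≤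
        8192 * (x.2 * (windowCard n x) ^ 2 : ℕ) := by
    rintro ⟨e, ρ⟩ hx
    simp only [mem_product, mem_filter, mem_range, mem_Ico] at hx
    obtain ⟨⟨he, heo, -⟩, hρ, hρ'⟩ := hx
    obtain ⟨hx0, hx1, hx2⟩ := scale_bounds hn he heo.pos hρ hρ'
    have he0 : (0 : ℝ) < e := by exact_mod_cast heo.pos
    have hρ0 : (0 : ℝ) < ρ := by
      exact_mod_cast lt_of_lt_of_le (pow_pos (by omega : 0 < n) 4) hρ
    have hsq : (2 * (ρ : ℝ) * √(2 * e)) ^ 2 = 8 * e * (ρ : ℝ) ^ 2 := by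
      rw [mul_pow, Real.sq_sqrt (by positivity)]; ring
    have hw : (n : ℝ) ^ 8 / (32 * (2 * ρ * √(2 * e))) ≤ windowCard n (e, ρ) := by
      have h1 := Nat.lt_floor_add_one ((n : ℝ) ^ 8 / (8 * (2 * ρ * √(2 * e))) / 2)
      have h2 : (n : ℝ) ^ 8 / (8 * (2 * ρ * √(2 * e))) / 2 =
          2 * ((n : ℝ) ^ 8 / (32 * (2 * ρ * √(2 * e)))) := by
        field_simp; norm_num
      have h3 : 2 ≤ (n : ℝ) ^ 8 / (32 * (2 * ρ * √(2 * e))) := by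
        rw [le_div_iff₀ (by positivity)]
        linarith
      simp only [windowCard]
      linarith
    have hw2 : ((n : ℝ) ^ 8 / (32 * (2 * ρ * √(2 * e)))) ^ 2 ≤ (windowCard n (e, ρ) : ℝ) ^ 2 := by
      gcongr
    rw [div_pow, mul_pow, hsq] at hw2
    push_cast
    calc ((n : ℝ) ^ 8) ^ 2 * ((e : ℝ)⁻¹ * (ρ : ℝ)⁻¹)
        = 8192 * (ρ * (((n : ℝ) ^ 8) ^ 2 / (32 ^ 2 * (8 * e * (ρ : ℝ) ^ 2)))) := by
          field_simp; norm_num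
      _ ≤ _ := by gcongr
  have hsum := sum_le_sum hterm
  rw [← mul_sum, ← mul_sum, ← Nat.cast_sum, sum_product] at hsum
  simp_rw [← mul_sum, ← sum_mul] at hsum
  have hcard : (paramSet n).card =
      ∑ x ∈ (range (2 * n)).filter (fun e => Odd e ∧ Squarefree e) ×ˢ Ico (n ^ 4) (n ^ 6),
        x.2 * (windowCard n x) ^ 2 := by
    simp [paramSet, sq]
  rw [← hcard] at hsum
  have hn0 : (0 : ℝ) < n := by exact_mod_cast (by omega : 0 < n)
  have hE := sum_inv_odd_squarefree_lower_bound n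
  have hlog : Real.log n ≤ Real.log (n + 1) := Real.log_le_log hn0 (by linarith)
  have hlog0 : 0 ≤ Real.log n := Real.log_natCast_nonneg n
  have hR := log_sub_log_le_sum_inv (pow_pos (by omega : 0 < n) 4)
    (Nat.pow_le_pow_right (by omega : 0 < n) (by norm_num : 4 ≤ 6))
  push_cast at hR
  rw [Real.log_pow, Real.log_pow] at hR
  push_cast at hR
  have hprod := mul_le_mul (hlog.trans hE)
    (by linarith : 2 * Real.log n ≤ ∑ k ∈ Ico (n ^ 4) (n ^ 6), (k : ℝ)⁻¹)
    (by positivity) (hlog0.trans (hlog.trans hE))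
  have := mul_le_mul_of_nonneg_left hprod (by positivity : (0 : ℝ) ≤ ((n : ℝ) ^ 8) ^ 2)
  nlinarith

open Polynomial in
/-- The set counted by `quarticGalCount G H`. -/
def quarticGalSet (G : Type*) [Group G] (H : ℝ) : Set (ℤ × ℤ × ℤ × ℤ) :=
  {p : ℤ × ℤ × ℤ × ℤ |
    |(p.1 : ℝ)| ≤ H ∧ |(p.2.1 : ℝ)| ≤ H ∧ |(p.2.2.1 : ℝ)| ≤ H ∧ |(p.2.2.2 : ℝ)| ≤ H ∧
    Irreducible (X ^ 4 + C (p.1 : ℚ) * X ^ 3 + C (p.2.1 : ℚ) * X ^ 2 + C (p.2.2.1 : ℚ) * X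
        + C (p.2.2.2 : ℚ)) ∧
    Nonempty
      ((X ^ 4 + C (p.1 : ℚ) * X ^ 3 + C (p.2.1 : ℚ) * X ^ 2 + C (p.2.2.1 : ℚ) * X
          + C (p.2.2.2 : ℚ)).Gal ≃* G)}

theorem finite_quarticGalSet (G : Type*) [Group G] (H : ℝ) : (quarticGalSet G H).Finite := by
  have hI : {k : ℤ | |(k : ℝ)| ≤ H}.Finite := by
    refine (Set.finite_Icc (-⌊H⌋) ⌊H⌋).subset fun k hk => ?_
    obtain ⟨h1, h2⟩ := abs_le.1 (Set.mem_ofPred.1 hk)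
    refine ⟨?_, Int.le_floor.2 h2⟩
    rw [neg_le]
    exact Int.le_floor.2 (by push_cast; linarith)
  exact (hI.prod (hI.prod (hI.prod hI))).subset
    fun p hp => ⟨hp.1, hp.2.1, hp.2.2.1, hp.2.2.2.1⟩

theorem paramCoeff_mem_union {n : ℕ} (hn : 200 ≤ n) {H : ℝ} (hH : (n : ℝ) ^ 8 ≤ H)
    {z : Σ _ : ℕ × ℕ, ℕ × ℕ × ℕ} (hz : z ∈ paramSet n) :
    paramCoeff z ∈ quarticGalSet (DihedralGroup 4) H ∪
      quarticGalSet (Multiplicative (ZMod 2 × ZMod 2)) H ∪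
        quarticGalSet (Multiplicative (ZMod 4)) H := by
  obtain ⟨h1, h2, h3, h4⟩ := abs_paramCoeff_le hn hz
  have hirr := irreducible_paramCoeff hz
  have hs : (2 * (z.1.2 : ℤ) + 2 * z.2.1 + 1) ≠ 0 := by positivity
  rcases gal_normQuartic hs rfl rfl hirr with h | h | h
  · exact Or.inl (Or.inl ⟨h1.trans hH, h2.trans hH, h3.trans hH, h4.trans hH, hirr, h⟩)
  · exact Or.inl (Or.inr ⟨h1.trans hH, h2.trans hH, h3.trans hH, h4.trans hH, hirr, h⟩)
  · exact Or.inr ⟨h1.trans hH, h2.trans hH, h3.trans hH, h4.trans hH, hirr, h⟩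

theorem card_paramSet_le {n : ℕ} (hn : 200 ≤ n) {H : ℝ} (hH : (n : ℝ) ^ 8 ≤ H) :
    (paramSet n).card ≤ 3 * (quarticGalCount (DihedralGroup 4) H
      + quarticGalCount (Multiplicative (ZMod 2 × ZMod 2)) H
      + quarticGalCount (Multiplicative (ZMod 4)) H) := by
  refine (Finset.card_le_mul_card_image (f := paramCoeff) (paramSet n) 3
    fun v _ => card_filter_paramCoeff_le n v).trans (Nat.mul_le_mul_left 3 ?_)
  rw [← Set.ncard_coe_finset]
  refine (Set.ncard_le_ncard (t := quarticGalSet (DihedralGroup 4) H ∪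
    quarticGalSet (Multiplicative (ZMod 2 × ZMod 2)) H ∪
      quarticGalSet (Multiplicative (ZMod 4)) H) ?_ ?_).trans ?_
  · intro v hv
    obtain ⟨z, hz, rfl⟩ := Finset.mem_image.1 (Finset.mem_coe.1 hv)
    exact paramCoeff_mem_union hn hH hz
  · exact ((finite_quarticGalSet _ H).union (finite_quarticGalSet _ H)).union
      (finite_quarticGalSet _ H)
  · exact (Set.ncard_union_le _ _).trans (Nat.add_le_add_right (Set.ncard_union_le _ _) _)

/-- The number of `D₄`, `V₄` and `C₄` quartics is bounded below by `c H² (log H)²`. -/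
theorem D4_V4_C4_lower_bound :
    ∃ c H₀ : ℝ, 0 < c ∧ 3 ≤ H₀ ∧ ∀ H : ℝ, H₀ ≤ H →
      c * H ^ 2 * (Real.log H) ^ 2
        ≤ (quarticGalCount (DihedralGroup 4) H : ℝ)
            + (quarticGalCount (Multiplicative (ZMod 2 × ZMod 2)) H : ℝ)
            + (quarticGalCount (Multiplicative (ZMod 4)) H : ℝ) := by
  refine ⟨(3 * 16384 * 256 ^ 3)⁻¹, 200 ^ 8, by positivity, by norm_num, fun H hH => ?_⟩
  have hH0 : 0 ≤ H := le_trans (by positivity) hH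
  have hroot : (H ^ ((8 : ℕ) : ℝ)⁻¹) ^ 8 = H := Real.rpow_inv_natCast_pow hH0 (by norm_num)
  have hroot0 : 0 ≤ H ^ ((8 : ℕ) : ℝ)⁻¹ := Real.rpow_nonneg hH0 _
  generalize H ^ ((8 : ℕ) : ℝ)⁻¹ = y at hroot hroot0
  subst hroot
  have hy : 200 ≤ y := le_of_pow_le_pow_left₀ (by norm_num) hroot0 hH
  have hn : 200 ≤ ⌊y⌋₊ := Nat.le_floor (by exact_mod_cast hy)
  have hny : (⌊y⌋₊ : ℝ) ≤ y := Nat.floor_le hroot0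
  have hyn : y < ⌊y⌋₊ + 1 := Nat.lt_floor_add_one y
  generalize ⌊y⌋₊ = n at hn hny hyn
  have hnR : (200 : ℝ) ≤ n := by exact_mod_cast hn
  have hcard : ((paramSet n).card : ℝ) ≤ _ :=
    Nat.cast_le.2 (card_paramSet_le hn (pow_le_pow_left₀ (by positivity) hny 8))
  push_cast at hcard
  have hlower := card_paramSet_lower_bound hn
  have hlog : Real.log (y ^ 8) ≤ 16 * Real.log n := by
    have h : Real.log y ≤ Real.log ((n : ℝ) ^ 2) :=
      Real.log_le_log (by linarith) (by nlinarith)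
    rw [Real.log_pow] at h ⊢
    push_cast at h ⊢
    linarith
  have hlog0 : 0 ≤ Real.log (y ^ 8) := Real.log_nonneg (one_le_pow₀ (by linarith))
  have hmain : (y ^ 8) ^ 2 * Real.log (y ^ 8) ^ 2 ≤
      256 ^ 3 * (((n : ℝ) ^ 8) ^ 2 * Real.log n ^ 2) := by
    calc (y ^ 8) ^ 2 * Real.log (y ^ 8) ^ 2
        ≤ ((2 * (n : ℝ)) ^ 8) ^ 2 * (16 * Real.log n) ^ 2 := by
          gcongr
          linarith
      _ = _ := by ring
  rw [mul_assoc, inv_mul_le_iff₀ (by positivity)]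
  linarith
end

section
/- Let I and J be integers with 4I³ ≠ J². Then the affine surface Y_{I,J} contains no rational lines; that is, for every point (α,γ,δ) ∈ ℚ³ and every nonzero direction vector (A,C,D) ∈ ℚ³, there exists t ∈ ℚ with g(α + tA, γ + tC, δ + tD) ≠ 0. -/
open Polynomial in
/-- If `P * Q ^ 2 = R ^ 2` with `deg P ≤ 2` and `Q ≠ 0`, then `P` is the square of a polynomial `S`
of degree at most one, and `R = S * Q`. -/
lemma Polynomial.exists_linear_sq_of_mul_sq_eq_sq {K : Type*} [Field K] {P Q R : K[X]}
    (hPQR : P * Q ^ 2 = R ^ 2) (hQ : Q ≠ 0) (hP : P.natDegree ≤ 2) :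
    ∃ p q : K, P = (C q * X + C p) ^ 2 ∧ R = (C q * X + C p) * Q := by
  have hdvd : Q ∣ R :=
    (IsIntegrallyClosed.pow_dvd_pow_iff two_ne_zero).1 ⟨P, by rw [← hPQR, mul_comm]⟩
  obtain ⟨S, rfl⟩ := hdvd
  have hS : P = S ^ 2 := by
    apply mul_right_cancel₀ (pow_ne_zero 2 hQ)
    rw [hPQR]
    ring
  have hdeg : S.natDegree ≤ 1 := by
    rw [hS, natDegree_pow] at hP
    omega
  obtain ⟨q, p, rfl⟩ := exists_eq_X_add_C_of_natDegree_le_one hdeg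
  exact ⟨p, q, hS, mul_comm _ _⟩

/-- A cubic polynomial function over `ℚ` that vanishes identically has zero coefficients. -/
lemma cubic_coeffs_eq_zero {k₀ k₁ k₂ k₃ : ℚ}
    (h : ∀ t : ℚ, k₀ + k₁ * t + k₂ * t ^ 2 + k₃ * t ^ 3 = 0) :
    k₀ = 0 ∧ k₁ = 0 ∧ k₂ = 0 ∧ k₃ = 0 := by
  have h0 := h 0
  have h1 := h 1
  have h2 := h (-1)
  have h3 := h 2
  norm_num at h0 h1 h2 h3
  refine ⟨?_, ?_, ?_, ?_⟩ <;> linarith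

open Polynomial in
/-- Along a line contained in the surface, either both squared factors vanish identically, or the
first factor is the square of a linear function. -/
lemma line_factorization {I J α γ δ A B D : ℚ}
    (h : ∀ t : ℚ, (I - 12 * (δ + t * D) + 3 * (α + t * A) * (γ + t * B))
          * (96 * (δ + t * D) + 3 * (α + t * A) * (γ + t * B) - 2 * I) ^ 2
        - (J + 27 * (γ + t * B) ^ 2 + 27 * (α + t * A) ^ 2 * (δ + t * D)) ^ 2 = 0) :
    (∀ t : ℚ, 96 * (δ + t * D) + 3 * (α + t * A) * (γ + t * B) - 2 * I = 0 ∧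
      J + 27 * (γ + t * B) ^ 2 + 27 * (α + t * A) ^ 2 * (δ + t * D) = 0) ∨
    ∃ p q : ℚ, ∀ t : ℚ,
      I - 12 * (δ + t * D) + 3 * (α + t * A) * (γ + t * B) = (q * t + p) ^ 2 ∧
      J + 27 * (γ + t * B) ^ 2 + 27 * (α + t * A) ^ 2 * (δ + t * D) =
        (q * t + p) * (96 * (δ + t * D) + 3 * (α + t * A) * (γ + t * B) - 2 * I) := by
  set P : ℚ[X] := C I - C 12 * (C δ + X * C D) + C 3 * (C α + X * C A) * (C γ + X * C B) with hP
  set Q : ℚ[X] :=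
    C 96 * (C δ + X * C D) + C 3 * (C α + X * C A) * (C γ + X * C B) - C (2 * I) with hQ
  set R : ℚ[X] :=
    C J + C 27 * (C γ + X * C B) ^ 2 + C 27 * (C α + X * C A) ^ 2 * (C δ + X * C D) with hR
  have eP (t : ℚ) :
      P.eval t = I - 12 * (δ + t * D) + 3 * (α + t * A) * (γ + t * B) := by
    simp only [hP, eval_add, eval_sub, eval_mul, eval_C, eval_X]
  have eQ (t : ℚ) :
      Q.eval t = 96 * (δ + t * D) + 3 * (α + t * A) * (γ + t * B) - 2 * I := by
    simp only [hQ, eval_add, eval_sub, eval_mul, eval_C, eval_X]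
  have eR (t : ℚ) :
      R.eval t = J + 27 * (γ + t * B) ^ 2 + 27 * (α + t * A) ^ 2 * (δ + t * D) := by
    simp only [hR, eval_add, eval_mul, eval_pow, eval_C, eval_X]
  have hPQR : P * Q ^ 2 = R ^ 2 := by
    refine Polynomial.funext fun t => ?_
    rw [eval_mul, eval_pow, eval_pow, eP, eQ, eR]
    exact sub_eq_zero.1 (h t)
  simp only [← eP, ← eQ, ← eR]
  by_cases hQ0 : Q = 0
  · left
    have hR0 : R = 0 := by simpa [hQ0] using hPQR.symm
    simp [hQ0, hR0]
  · right
    have hdeg : P.natDegree ≤ 2 := by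
      rw [hP]
      compute_degree
    obtain ⟨p, q, h1, h2⟩ := exists_linear_sq_of_mul_sq_eq_sq hPQR hQ0 hdeg
    refine ⟨p, q, fun t => ⟨?_, ?_⟩⟩
    · rw [h1]
      simp
    · rw [h2]
      simp

/-- If the surface contains a line on which the coordinate `a` is a parameter, then
`4 I ^ 3 = J ^ 2`. -/
lemma four_mul_cube_eq_sq_of_line {I J γ δ B D : ℚ}
    (h : ∀ t : ℚ, (I - 12 * (δ + t * D) + 3 * (0 + t * 1) * (γ + t * B))
          * (96 * (δ + t * D) + 3 * (0 + t * 1) * (γ + t * B) - 2 * I) ^ 2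
        - (J + 27 * (γ + t * B) ^ 2 + 27 * (0 + t * 1) ^ 2 * (δ + t * D)) ^ 2 = 0) :
    4 * I ^ 3 = J ^ 2 := by
  rcases line_factorization h with h | ⟨p, q, h⟩
  · obtain ⟨q0, q1, q2, -⟩ := cubic_coeffs_eq_zero
      (k₀ := 96 * δ - 2 * I) (k₁ := 96 * D + 3 * γ) (k₂ := 3 * B) (k₃ := 0)
      fun t => by linear_combination (h t).1
    obtain ⟨r0, -, r2, r3⟩ := cubic_coeffs_eq_zero
      (k₀ := J + 27 * γ ^ 2) (k₁ := 54 * γ * B) (k₂ := 27 * B ^ 2 + 27 * δ) (k₃ := 27 * D)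
      fun t => by linear_combination (h t).2
    obtain rfl : B = 0 := by linarith
    obtain rfl : D = 0 := by linarith
    obtain rfl : γ = 0 := by linarith
    obtain rfl : δ = 0 := by linarith
    obtain rfl : I = 0 := by linarith
    obtain rfl : J = 0 := by linarith
    norm_num
  · obtain ⟨p0, p1, p2, -⟩ := cubic_coeffs_eq_zero
      (k₀ := I - 12 * δ - p ^ 2) (k₁ := 3 * γ - 12 * D - 2 * p * q) (k₂ := 3 * B - q ^ 2)
      (k₃ := 0) fun t => by linear_combination (h t).1
    obtain ⟨r0, -, r2, r3⟩ := cubic_coeffs_eq_zero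
      (k₀ := J + 27 * γ ^ 2 - p * (96 * δ - 2 * I))
      (k₁ := 54 * γ * B - p * (96 * D + 3 * γ) - q * (96 * δ - 2 * I))
      (k₂ := 27 * B ^ 2 + 27 * δ - 3 * B * p - q * (96 * D + 3 * γ))
      (k₃ := 27 * D - 3 * B * q) fun t => by linear_combination (h t).2
    obtain rfl : B = q ^ 2 / 3 := by linarith
    obtain rfl : D = q ^ 3 / 27 := by linear_combination r3 / 27
    obtain rfl : γ = 2 * p * q / 3 + 4 * q ^ 3 / 27 := by linear_combination p1 / 3
    obtain rfl : δ = (I - p ^ 2) / 12 := by linear_combination -p0 / 12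
    obtain rfl : I = (p + 2 * q ^ 2 / 3) ^ 2 := by linear_combination 4 * r2 / 9
    obtain rfl : J = -2 * (p + 2 * q ^ 2 / 3) ^ 3 := by linear_combination r0
    ring

/-- The surface contains no line on which the coordinate `a` is constant. -/
lemma direction_eq_zero_of_line_of_const {I J α γ δ B D : ℚ}
    (h : ∀ t : ℚ, (I - 12 * (δ + t * D) + 3 * (α + t * 0) * (γ + t * B))
          * (96 * (δ + t * D) + 3 * (α + t * 0) * (γ + t * B) - 2 * I) ^ 2
        - (J + 27 * (γ + t * B) ^ 2 + 27 * (α + t * 0) ^ 2 * (δ + t * D)) ^ 2 = 0) :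
    B = 0 ∧ D = 0 := by
  rcases line_factorization h with h | ⟨p, q, h⟩
  · obtain ⟨-, q1, -, -⟩ := cubic_coeffs_eq_zero
      (k₀ := 96 * δ + 3 * α * γ - 2 * I) (k₁ := 96 * D + 3 * α * B) (k₂ := 0) (k₃ := 0)
      fun t => by linear_combination (h t).1
    obtain ⟨-, -, r2, -⟩ := cubic_coeffs_eq_zero
      (k₀ := J + 27 * γ ^ 2 + 27 * α ^ 2 * δ) (k₁ := 54 * γ * B + 27 * α ^ 2 * D)
      (k₂ := 27 * B ^ 2) (k₃ := 0)
      fun t => by linear_combination (h t).2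
    obtain rfl : B = 0 := by simpa using r2
    exact ⟨rfl, by linarith⟩
  · obtain ⟨-, p1, p2, -⟩ := cubic_coeffs_eq_zero
      (k₀ := I - 12 * δ + 3 * α * γ - p ^ 2) (k₁ := 3 * α * B - 12 * D - 2 * p * q)
      (k₂ := -q ^ 2) (k₃ := 0) fun t => by linear_combination (h t).1
    obtain rfl : q = 0 := by simpa using p2
    obtain ⟨-, -, r2, -⟩ := cubic_coeffs_eq_zero
      (k₀ := J + 27 * γ ^ 2 + 27 * α ^ 2 * δ - p * (96 * δ + 3 * α * γ - 2 * I))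
      (k₁ := 54 * γ * B + 27 * α ^ 2 * D - p * (96 * D + 3 * α * B))
      (k₂ := 27 * B ^ 2) (k₃ := 0) fun t => by linear_combination (h t).2
    obtain rfl : B = 0 := by simpa using r2
    exact ⟨rfl, by linarith⟩

/-- For integers `I, J` with `4I³ ≠ J²`, the affine surface
`g(a,c,d) = (I − 12d + 3ac)(96d + 3ac − 2I)² − (J + 27c² + 27a²d)² = 0`
contains no rational lines. -/
theorem surface_no_rational_lines (I J : ℤ) (h : 4 * I ^ 3 ≠ J ^ 2)
    (α γ δ A B D : ℚ) (hv : (A, B, D) ≠ (0, 0, 0)) :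
    ∃ t : ℚ,
      ((I : ℚ) - 12 * (δ + t * D) + 3 * (α + t * A) * (γ + t * B))
          * (96 * (δ + t * D) + 3 * (α + t * A) * (γ + t * B) - 2 * (I : ℚ)) ^ 2
        - ((J : ℚ) + 27 * (γ + t * B) ^ 2 + 27 * (α + t * A) ^ 2 * (δ + t * D)) ^ 2 ≠ 0 := by
  by_contra! hline
  by_cases hA : A = 0
  · subst hA
    obtain ⟨rfl, rfl⟩ := direction_eq_zero_of_line_of_const hline
    exact hv rfl
  · have hIJ : 4 * (I : ℚ) ^ 3 = (J : ℚ) ^ 2 := by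
      apply four_mul_cube_eq_sq_of_line (γ := γ - α / A * B) (δ := δ - α / A * D)
        (B := B / A) (D := D / A)
      intro t
      have ha : α + (t - α) / A * A = 0 + t * 1 := by
        field_simp
        ring
      have hc : γ + (t - α) / A * B = γ - α / A * B + t * (B / A) := by ring
      have hd : δ + (t - α) / A * D = δ - α / A * D + t * (D / A) := by ring
      rw [← ha, ← hc, ← hd]
      exact hline _
    exact h (by exact_mod_cast hIJ)
end

section
/- Let I and J be integers with 4I³ ≠ J². Then the polynomial g(a,c,d) = (I − 12d + 3ac)·(96d + 3ac − 2I)² − (J + 27c² + 27a²d)², regarded as an element of the polynomial ring ℂ[a,c,d], is irreducible; that is, the affine surface Y_{I,J} is absolutely irreducible. -/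
open MvPolynomial

/-- A polynomial `p(c)` cannot satisfy `(I - 12p)(96p - 2I)² = (J + 27c²)²`: the left side has
degree divisible by `3`, the right side has degree `4`. -/
theorem sub_mul_sub_sq_ne_sq (i j : ℂ) (p : Polynomial ℂ) :
    (Polynomial.C i - Polynomial.C 12 * p) * (Polynomial.C 96 * p - Polynomial.C (2 * i)) ^ 2 ≠
      (Polynomial.C 27 * Polynomial.X ^ 2 + Polynomial.C j) ^ 2 := by
  intro h
  have h₁ : (Polynomial.C i - Polynomial.C 12 * p).natDegree = p.natDegree := by
    rw [sub_eq_neg_add, Polynomial.natDegree_add_C, Polynomial.natDegree_neg,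
      Polynomial.natDegree_C_mul (by norm_num)]
  have h₂ : (Polynomial.C 96 * p - Polynomial.C (2 * i)).natDegree = p.natDegree := by
    rw [Polynomial.natDegree_sub_C, Polynomial.natDegree_C_mul (by norm_num)]
  have h₃ : (Polynomial.C 27 * Polynomial.X ^ 2 + Polynomial.C j : Polynomial ℂ).natDegree = 2 := by
    rw [Polynomial.natDegree_add_C, Polynomial.natDegree_C_mul_X_pow _ _ (by norm_num)]
  have hne : (Polynomial.C 27 * Polynomial.X ^ 2 + Polynomial.C j : Polynomial ℂ) ^ 2 ≠ 0 :=
    pow_ne_zero _ (Polynomial.ne_zero_of_natDegree_gt (n := 0) (by omega))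
  rw [← h] at hne
  have hd := congrArg Polynomial.natDegree h
  rw [Polynomial.natDegree_mul (left_ne_zero_of_mul hne) (right_ne_zero_of_mul hne),
    Polynomial.natDegree_pow, Polynomial.natDegree_pow, h₁, h₂, h₃] at hd
  omega

/-- The isomorphism `ℂ[a,c,d] ≃ ℂ[c,a][d]`. -/
noncomputable def lastVariableEquiv :
    MvPolynomial (Fin 3) ℂ ≃ₐ[ℂ] Polynomial (MvPolynomial (Fin 2) ℂ) :=
  (renameEquiv ℂ (Equiv.swap (0 : Fin 3) 2)).trans (finSuccEquiv ℂ 2)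

theorem lastVariableEquiv_C (z : ℂ) : lastVariableEquiv (C z) = Polynomial.C (C z) := by
  simp [lastVariableEquiv, finSuccEquiv_apply]

theorem lastVariableEquiv_X_zero : lastVariableEquiv (X 0) = Polynomial.C (X 1) := by
  have : (2 : Fin 3) = Fin.succ 1 := rfl
  simp only [lastVariableEquiv, AlgEquiv.trans_apply, renameEquiv_apply, rename_X,
    Equiv.swap_apply_left]
  rw [this, finSuccEquiv_X_succ]

theorem lastVariableEquiv_X_one : lastVariableEquiv (X 1) = Polynomial.C (X 0) := by
  have h : Equiv.swap (0 : Fin 3) 2 1 = Fin.succ 0 := by decide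
  simp only [lastVariableEquiv, AlgEquiv.trans_apply, renameEquiv_apply, rename_X]
  rw [h, finSuccEquiv_X_succ]

theorem lastVariableEquiv_X_two : lastVariableEquiv (X 2) = Polynomial.X := by
  simp only [lastVariableEquiv, AlgEquiv.trans_apply, renameEquiv_apply, rename_X,
    Equiv.swap_apply_right, finSuccEquiv_X_zero]

theorem degree_quadratic_lt_three {R : Type*} [Semiring R] (x y z : R) :
    (Polynomial.C x * Polynomial.X ^ 2 + Polynomial.C y * Polynomial.X +
      Polynomial.C z).degree < ((3 : ℕ) : WithBot ℕ) :=
  lt_of_le_of_lt Polynomial.degree_quadratic_le (by exact_mod_cast Nat.lt_succ_self 2)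

/-- The monic cubic in `d` obtained from `(u - 12d)(96d + v)² - (w + 27a²d)²` on dividing by its
leading coefficient `-110592`. -/
noncomputable def monicCubic {R : Type*} [CommRing R] [Algebra ℂ R] (a u v w : R) :
    Polynomial R :=
  Polynomial.X ^ 3 +
    (Polynomial.C (algebraMap ℂ R (-1 / 110592) * (9216 * u - 2304 * v - 729 * a ^ 4)) *
        Polynomial.X ^ 2 +
      Polynomial.C (algebraMap ℂ R (-1 / 110592) * (192 * u * v - 12 * v ^ 2 - 54 * a ^ 2 * w)) *
        Polynomial.X +
      Polynomial.C (algebraMap ℂ R (-1 / 110592) * (u * v ^ 2 - w ^ 2)))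

section monicCubic

variable {R : Type*} [CommRing R] [Algebra ℂ R] (a u v w : R)

theorem monicCubic_monic : (monicCubic a u v w).Monic :=
  Polynomial.monic_X_pow_add (degree_quadratic_lt_three _ _ _)

theorem natDegree_monicCubic [Nontrivial R] : (monicCubic a u v w).natDegree = 3 := by
  apply Polynomial.natDegree_eq_of_degree_eq_some
  rw [monicCubic, Polynomial.degree_add_eq_left_of_degree_lt, Polynomial.degree_X_pow]
  rw [Polynomial.degree_X_pow]
  exact degree_quadratic_lt_three _ _ _

theorem C_mul_monicCubic :
    Polynomial.C (algebraMap ℂ R (-110592)) * monicCubic a u v w =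
      (Polynomial.C u - 12 * Polynomial.X) * (96 * Polynomial.X + Polynomial.C v) ^ 2 -
        (Polynomial.C w + 27 * Polynomial.C a ^ 2 * Polynomial.X) ^ 2 := by
  have h : Polynomial.C (algebraMap ℂ R (-110592)) *
      Polynomial.C (algebraMap ℂ R (-1 / 110592)) = 1 := by
    rw [← map_mul, ← map_mul]; norm_num
  have h' : Polynomial.C (algebraMap ℂ R (-110592)) = (-110592 : Polynomial R) := by
    rw [map_neg, map_neg, map_ofNat, map_ofNat]
  simp only [monicCubic, map_mul, map_sub, map_pow, map_ofNat]
  generalize Polynomial.C (algebraMap ℂ R (-1 / 110592)) = k at *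
  rw [h'] at *
  linear_combination
    ((9216 * Polynomial.C u - 2304 * Polynomial.C v - 729 * Polynomial.C a ^ 4) *
        Polynomial.X ^ 2 +
      (192 * Polynomial.C u * Polynomial.C v - 12 * Polynomial.C v ^ 2 -
        54 * Polynomial.C a ^ 2 * Polynomial.C w) * Polynomial.X +
      (Polynomial.C u * Polynomial.C v ^ 2 - Polynomial.C w ^ 2)) * h

theorem map_monicCubic {S : Type*} [CommRing S] [Algebra ℂ S] (f : R →ₐ[ℂ] S) :
    (monicCubic a u v w).map (f : R →+* S) = monicCubic (f a) (f u) (f v) (f w) := by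
  simp only [monicCubic, Polynomial.map_add, Polynomial.map_mul, Polynomial.map_pow,
    Polynomial.map_sub, Polynomial.map_ofNat, Polynomial.map_X, Polynomial.map_C, RingHom.coe_coe,
    map_mul, map_sub, map_pow, map_ofNat, AlgHom.commutes]

end monicCubic

theorem irreducible_monicCubic_zero (i j : ℂ) :
    Irreducible (monicCubic (0 : Polynomial ℂ) (Polynomial.C i) (-Polynomial.C (2 * i))
      (Polynomial.C 27 * Polynomial.X ^ 2 + Polynomial.C j)) := by
  rw [(monicCubic_monic _ _ _ _).irreducible_iff_roots_eq_zero_of_degree_le_three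
    (by rw [natDegree_monicCubic]; norm_num) (by rw [natDegree_monicCubic]),
    Multiset.eq_zero_iff_forall_notMem]
  intro p hp
  have hroot := (Polynomial.mem_roots'.mp hp).2
  have h := congrArg (Polynomial.eval p) (C_mul_monicCubic (0 : Polynomial ℂ) (Polynomial.C i)
    (-Polynomial.C (2 * i)) (Polynomial.C 27 * Polynomial.X ^ 2 + Polynomial.C j))
  rw [Polynomial.eval_mul, hroot.eq_zero, mul_zero] at h
  apply sub_mul_sub_sq_ne_sq i j p
  simp only [Polynomial.eval_sub, Polynomial.eval_mul, Polynomial.eval_pow, Polynomial.eval_add,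
    Polynomial.eval_C, Polynomial.eval_X, Polynomial.eval_ofNat] at h
  simp only [map_ofNat] at h ⊢
  linear_combination -h

/-- For integers `I, J` with `4I³ ≠ J²`, the polynomial
`g(a,c,d) = (I − 12d + 3ac)(96d + 3ac − 2I)² − (J + 27c² + 27a²d)²` is irreducible
over `ℂ`; that is, the surface `Y_{I,J}` is absolutely irreducible.
Here `X 0 = a`, `X 1 = c`, `X 2 = d`. -/
theorem surface_absolutely_irreducible (I J : ℤ) (h : 4 * I ^ 3 ≠ J ^ 2) :
    Irreducible
      (((C (I : ℂ) - 12 * X 2 + 3 * X 0 * X 1)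
          * (96 * X 2 + 3 * X 0 * X 1 - 2 * C (I : ℂ)) ^ 2
        - (C (J : ℂ) + 27 * X 1 ^ 2 + 27 * X 0 ^ 2 * X 2) ^ 2 :
        MvPolynomial (Fin 3) ℂ)) := by
  rw [← MulEquiv.irreducible_iff lastVariableEquiv]
  set u : MvPolynomial (Fin 2) ℂ := C (I : ℂ) + 3 * X 1 * X 0 with hu
  set v : MvPolynomial (Fin 2) ℂ := 3 * X 1 * X 0 - 2 * C (I : ℂ) with hv
  set w : MvPolynomial (Fin 2) ℂ := C (J : ℂ) + 27 * X 0 ^ 2 with hw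
  have hirr : Irreducible (monicCubic (X 1) u v w) := by
    let f : MvPolynomial (Fin 2) ℂ →ₐ[ℂ] Polynomial ℂ := aeval ![Polynomial.X, 0]
    refine (monicCubic_monic _ _ _ _).irreducible_of_irreducible_map
      (f : MvPolynomial (Fin 2) ℂ →+* Polynomial ℂ) _ ?_
    rw [map_monicCubic]
    convert irreducible_monicCubic_zero (I : ℂ) (J : ℂ) using 2
    · simp [f]
    · simp [f, hu]
    · simp [f, hv, map_ofNat Polynomial.C]
    · simp [f, hw, add_comm, map_ofNat Polynomial.C]
  have hunit : IsUnit
      (Polynomial.C (algebraMap ℂ (MvPolynomial (Fin 2) ℂ) (-110592))) :=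
    ((IsUnit.mk0 (-110592 : ℂ) (by norm_num)).map _).map _
  convert (irreducible_isUnit_mul hunit).mpr hirr using 1
  rw [C_mul_monicCubic]
  simp only [map_sub, map_mul, map_add, map_pow, map_ofNat, lastVariableEquiv_C,
    lastVariableEquiv_X_zero, lastVariableEquiv_X_one, lastVariableEquiv_X_two, hu, hv, hw]
  ring
end

section
/- Let I, J ∈ ℂ with 4I³ − J² ≠ 0. Then the affine subvariety Z_{I,J} of ℂ⁵ defined by the two equations 12ae − 3bd + c² = I and 72ace + 9bcd − 27ad² − 27b²e − 2c³ = J contains no lines; that is, for every point p ∈ ℂ⁵ and every nonzero vector v ∈ ℂ⁵, there exists t ∈ ℂ such that p + t·v does not lie in Z_{I,J}. -/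
/-- The quadratic invariant of the binary quartic form `(a, b, c, d, e)`. -/
def quarticI (a b c d e : ℂ) : ℂ := 12 * a * e - 3 * b * d + c ^ 2

/-- The cubic invariant of the binary quartic form `(a, b, c, d, e)`. -/
def quarticJ (a b c d e : ℂ) : ℂ :=
  72 * a * c * e + 9 * b * c * d - 27 * a * d ^ 2 - 27 * b ^ 2 * e - 2 * c ^ 3

/-- The line through `(a, b, c, d, e)` with direction `(A, B, C, D, E)` lies in `Z_{I,J}`. -/
def QuarticLine (I J a b c d e A B C D E : ℂ) : Prop :=
  ∀ t : ℂ,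
    quarticI (a + t * A) (b + t * B) (c + t * C) (d + t * D) (e + t * E) = I ∧
    quarticJ (a + t * A) (b + t * B) (c + t * C) (d + t * D) (e + t * E) = J

namespace QuarticLine

variable {I J a b c d e A B C D E : ℂ}

/-- Exchanging the two variables of the forms. -/
theorem reverse (h : QuarticLine I J a b c d e A B C D E) :
    QuarticLine I J e d c b a E D C B A := by
  intro t
  obtain ⟨h₁, h₂⟩ := h t
  unfold quarticI at *
  unfold quarticJ at *
  exact ⟨by linear_combination h₁, by linear_combination h₂⟩

/-- The substitution `X ↦ X + sY`. -/
theorem shear (h : QuarticLine I J a b c d e A B C D E) (s : ℂ) :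
    QuarticLine I J
      a (4 * a * s + b) (6 * a * s ^ 2 + 3 * b * s + c)
      (4 * a * s ^ 3 + 3 * b * s ^ 2 + 2 * c * s + d)
      (a * s ^ 4 + b * s ^ 3 + c * s ^ 2 + d * s + e)
      A (4 * A * s + B) (6 * A * s ^ 2 + 3 * B * s + C)
      (4 * A * s ^ 3 + 3 * B * s ^ 2 + 2 * C * s + D)
      (A * s ^ 4 + B * s ^ 3 + C * s ^ 2 + D * s + E) := by
  intro t
  obtain ⟨h₁, h₂⟩ := h t
  unfold quarticI at *
  unfold quarticJ at *
  exact ⟨by linear_combination h₁, by linear_combination h₂⟩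

theorem quarticI_direction (h : QuarticLine I J a b c d e A B C D E) :
    quarticI A B C D E = 0 := by
  have h₀ := (h 0).1
  have h₁ := (h 1).1
  have h₂ := (h (-1)).1
  unfold quarticI at *
  linear_combination (h₁ + h₂ - 2 * h₀) / 2

theorem quarticJ_direction (h : QuarticLine I J a b c d e A B C D E) :
    quarticJ A B C D E = 0 := by
  have h₀ := (h 0).2
  have h₁ := (h 1).2
  have h₂ := (h (-1)).2
  have h₃ := (h 2).2
  unfold quarticJ at *
  linear_combination (h₃ - 3 * h₁ + 3 * h₀ - h₂) / 6

/-- The direction `X³(AX + BY)` forces a double root in every form of the line. -/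
theorem discr_eq_zero_of_cube (h : QuarticLine I J a b c d e A B 0 0 0)
    (hv : A ≠ 0 ∨ B ≠ 0) : 4 * I ^ 3 - J ^ 2 = 0 := by
  obtain ⟨i₀, j₀⟩ := h 0
  obtain ⟨i₁, j₁⟩ := h 1
  have j₂ := (h (-1)).2
  unfold quarticI at *
  unfold quarticJ at *
  have hi : 4 * A * e - B * d = 0 := by linear_combination (i₁ - i₀) / 3
  have hj : B ^ 2 * e = 0 := by linear_combination -(j₁ + j₂ - 2 * j₀) / 54
  have hj' : 8 * A * c * e + B * c * d - 3 * A * d ^ 2 - 6 * b * B * e = 0 := by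
    linear_combination (j₁ - j₂) / 18
  have hde : d = 0 ∧ e = 0 := by
    by_cases hB : B = 0
    · have hA : A ≠ 0 := by tauto
      subst hB
      have he : e = 0 := by simpa [hA] using hi
      subst he
      exact ⟨by simpa [hA] using hj', rfl⟩
    · have he : e = 0 := by simpa [hB] using hj
      subst he
      exact ⟨by simpa [hB] using hi, rfl⟩
  obtain ⟨rfl, rfl⟩ := hde
  rw [← i₀, ← j₀]
  ring

/-- A direction with a root at infinity. -/
theorem discr_eq_zero_of_root (h : QuarticLine I J a b c d e 0 B C D E)
    (hv : B ≠ 0 ∨ C ≠ 0 ∨ D ≠ 0 ∨ E ≠ 0) : 4 * I ^ 3 - J ^ 2 = 0 := by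
  have hI := h.quarticI_direction
  have hJ := h.quarticJ_direction
  unfold quarticI at hI
  unfold quarticJ at hJ
  by_cases hB : B = 0
  · subst hB
    have hC : C = 0 := by simpa using hI
    subst hC
    exact h.reverse.discr_eq_zero_of_cube (by tauto)
  · have hD : D = C ^ 2 / (3 * B) := by
      field_simp
      linear_combination -hI
    have hE : E = C ^ 3 / (27 * B ^ 2) := by
      field_simp
      linear_combination -hJ - 3 * C * hI
    have hs := h.shear (-C / (3 * B))
    have hC' : 6 * 0 * (-C / (3 * B)) ^ 2 + 3 * B * (-C / (3 * B)) + C = 0 := by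
      field_simp
      ring
    have hD' : 4 * 0 * (-C / (3 * B)) ^ 3 + 3 * B * (-C / (3 * B)) ^ 2
        + 2 * C * (-C / (3 * B)) + D = 0 := by
      rw [hD]
      field_simp
      ring
    have hE' : 0 * (-C / (3 * B)) ^ 4 + B * (-C / (3 * B)) ^ 3 + C * (-C / (3 * B)) ^ 2
        + D * (-C / (3 * B)) + E = 0 := by
      rw [hD, hE]
      field_simp
      ring
    rw [hC', hD', hE'] at hs
    exact hs.discr_eq_zero_of_cube (Or.inr (by simpa using hB))

theorem discr_eq_zero (h : QuarticLine I J a b c d e A B C D E)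
    (hv : (A, B, C, D, E) ≠ (0, 0, 0, 0, 0)) : 4 * I ^ 3 - J ^ 2 = 0 := by
  by_cases hA : A = 0
  · subst hA
    refine h.discr_eq_zero_of_root ?_
    by_contra! hn
    simp [hn] at hv
  · open Polynomial in
    obtain ⟨s, hs⟩ : ∃ s : ℂ, A * s ^ 4 + B * s ^ 3 + C * s ^ 2 + D * s + E = 0 := by
      set p : ℂ[X] := Polynomial.C A * X ^ 4 + (Polynomial.C B * X ^ 3 + Polynomial.C C * X ^ 2
        + Polynomial.C D * X + Polynomial.C E)
      have hp : p.degree = 4 := by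
        unfold p
        compute_degree!
      obtain ⟨s, hs⟩ := IsAlgClosed.exists_root p (by rw [hp]; decide)
      refine ⟨s, ?_⟩
      simp only [p, IsRoot.def, eval_add, eval_mul, eval_C, eval_pow, eval_X] at hs
      linear_combination hs
    have h' := h.shear s
    rw [hs] at h'
    exact h'.reverse.discr_eq_zero_of_root (by tauto)

end QuarticLine


/-- For `I, J ∈ ℂ` with `4I³ − J² ≠ 0`, the variety of binary quartic forms
`(a,b,c,d,e)` with invariants `I` and `J` contains no complex lines. -/
theorem binary_quartic_invariants_no_lines (I J : ℂ) (h : 4 * I ^ 3 - J ^ 2 ≠ 0)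
    (α β γ δ ε A B 𝒞 D E : ℂ) (hv : (A, B, 𝒞, D, E) ≠ (0, 0, 0, 0, 0)) :
    ∃ t : ℂ,
      ¬ (12 * (α + t * A) * (ε + t * E) - 3 * (β + t * B) * (δ + t * D)
            + (γ + t * 𝒞) ^ 2 = I ∧
         72 * (α + t * A) * (γ + t * 𝒞) * (ε + t * E)
            + 9 * (β + t * B) * (γ + t * 𝒞) * (δ + t * D)
            - 27 * (α + t * A) * (δ + t * D) ^ 2
            - 27 * (β + t * B) ^ 2 * (ε + t * E)
            - 2 * (γ + t * 𝒞) ^ 3 = J) := by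
  by_contra! hn
  have hl : QuarticLine I J α β γ δ ε A B 𝒞 D E := hn
  exact h (hl.discr_eq_zero hv)
end

section
/- There exist constants c > 0 and H₀ ≥ 2 such that for all real H ≥ H₀ one has N_{V₄}(H) ≥ c·H^{3/2}. -/
section

open Polynomial IntermediateField

/-- The polynomial `X⁴ + bX² + t²` over `ℚ`, in the shape used by `quarticGalCount`. -/
lemma biquadratic_eq (b t : ℤ) :
    (X ^ 4 + C (((0 : ℤ) : ℚ)) * X ^ 3 + C (b : ℚ) * X ^ 2 + C (((0 : ℤ) : ℚ)) * X
      + C (((t ^ 2 : ℤ)) : ℚ) : ℚ[X]) = X ^ 4 + C (b : ℚ) * X ^ 2 + C ((t : ℚ) ^ 2) := by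
  simp

lemma natDegree_biquadratic {F : Type*} [Field F] (b d : F) :
    (X ^ 4 + C b * X ^ 2 + C d : F[X]).natDegree = 4 := by
  compute_degree!

lemma monic_biquadratic {F : Type*} [Field F] (b d : F) :
    (X ^ 4 + C b * X ^ 2 + C d : F[X]).Monic := by
  monicity!

lemma irreducible_biquadratic {b t : ℚ} (ht : 0 < t) (hb : 2 * t < b)
    (hsq : ¬ IsSquare (b ^ 2 - 4 * t ^ 2)) :
    Irreducible (X ^ 4 + C b * X ^ 2 + C (t ^ 2) : ℚ[X]) := by
  rw [(monic_biquadratic _ _).irreducible_iff_natDegree']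
  refine ⟨fun h => ?_, fun f g hf hg hfg hdeg => ?_⟩
  · have := natDegree_biquadratic b (t ^ 2)
    rw [h, natDegree_one] at this
    omega
  rw [natDegree_biquadratic, Finset.mem_Ioc] at hdeg
  have hd : f.natDegree + g.natDegree = 4 := by
    rw [← hf.natDegree_mul hg, hfg, natDegree_biquadratic]
  obtain hg1 | hg2 : g.natDegree = 1 ∨ g.natDegree = 2 := by omega
  · obtain ⟨x, hx⟩ := exists_root_of_degree_eq_one (degree_eq_iff_natDegree_eq_of_pos one_pos |>.2 hg1)
    have h := congrArg (eval x) hfg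
    rw [eval_mul, hx.eq_zero, mul_zero] at h
    simp at h
    nlinarith [sq_nonneg x, sq_nonneg (x ^ 2), mul_nonneg (by linarith : 0 ≤ b) (sq_nonneg x),
      pow_pos ht 2]
  · have hf2 : f.natDegree = 2 := by omega
    have hf' : f = X ^ 2 + C (f.coeff 1) * X + C (f.coeff 0) := by
      conv_lhs => rw [hf.as_sum, hf2]
      simp [Finset.sum_range_succ]; ring
    have hg' : g = X ^ 2 + C (g.coeff 1) * X + C (g.coeff 0) := by
      conv_lhs => rw [hg.as_sum, hg2]
      simp [Finset.sum_range_succ]; ring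
    generalize f.coeff 1 = p at hf'
    generalize f.coeff 0 = q at hf'
    generalize g.coeff 1 = r at hg'
    generalize g.coeff 0 = s at hg'
    have hmul : f * g = X ^ 4 + C (p + r) * X ^ 3 + C (q + s + p * r) * X ^ 2
        + C (p * s + q * r) * X + C (q * s) := by
      rw [hf', hg']; simp only [map_add, map_mul]; ring
    rw [hmul] at hfg
    have h3 := congrArg (fun P => coeff P 3) hfg
    have h2 := congrArg (fun P => coeff P 2) hfg
    have h1 := congrArg (fun P => coeff P 1) hfg
    have h0 := congrArg (fun P => coeff P 0) hfg
    simp [coeff_X, coeff_C, coeff_X_pow, -map_add, -map_mul, -map_pow] at h3 h2 h1 h0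
    obtain rfl : r = -p := by linarith
    have : p * (s - q) = 0 := by linarith
    rcases mul_eq_zero.1 this with rfl | h
    · exact hsq ⟨q - s, by linear_combination (-b - (q + s)) * h2 + 4 * h0⟩
    · obtain rfl : s = q := by linarith
      have : (s - t) * (s + t) = 0 := by linear_combination h0
      rcases mul_eq_zero.1 this with h | h <;> nlinarith [sq_nonneg p]

section Gal

universe u

variable {F : Type u} [Field F] {b t : F}

lemma aeval_biquadratic_eq_zero {L : Type*} [Field L] [Algebra F L] {x : L} :
    aeval x (X ^ 4 + C b * X ^ 2 + C (t ^ 2) : F[X]) = 0 ↔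
      x ^ 4 + algebraMap F L b * x ^ 2 + algebraMap F L t ^ 2 = 0 := by
  simp

/-- Any two roots of `x⁴ + bx² + t²` agree up to sign, or have product `± t`. -/
lemma biquadratic_roots {L : Type*} [Field L] {b t x y : L}
    (hx : x ^ 4 + b * x ^ 2 + t ^ 2 = 0) (hy : y ^ 4 + b * y ^ 2 + t ^ 2 = 0) :
    (y = x ∨ y = -x) ∨ (x * y = t ∨ x * y = -t) := by
  rw [← sq_eq_sq_iff_eq_or_eq_neg, ← sq_eq_sq_iff_eq_or_eq_neg, ← sub_eq_zero,
    ← sub_eq_zero (a := (x * y) ^ 2), ← mul_eq_zero]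
  linear_combination x ^ 2 * hy - y ^ 2 * hx

lemma ne_zero_of_biquadratic_root {L : Type*} [Field L] {b t x : L} (ht : t ≠ 0)
    (hx : x ^ 4 + b * x ^ 2 + t ^ 2 = 0) : x ≠ 0 := by
  rintro rfl
  simp_all

lemma algEquiv_apply_apply_biquadratic_root {L : Type*} [Field L] [Algebra F L] (ht : t ≠ 0)
    (σ : L ≃ₐ[F] L) {x : L}
    (hx : x ^ 4 + algebraMap F L b * x ^ 2 + algebraMap F L t ^ 2 = 0) : σ (σ x) = x := by
  have hx0 : x ≠ 0 :=
    ne_zero_of_biquadratic_root ((_root_.map_ne_zero (algebraMap F L)).2 ht) hx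
  have hy : σ x ^ 4 + algebraMap F L b * σ x ^ 2 + algebraMap F L t ^ 2 = 0 := by
    simpa using congrArg σ hx
  have hσ0 : σ x ≠ 0 := by simpa using hx0
  rcases biquadratic_roots hx hy with (h | h) | (h | h)
  · rw [h, h]
  · rw [h, map_neg, h, neg_neg]
  · have h' := congrArg σ h
    rw [map_mul, AlgEquiv.commutes, ← h, mul_comm] at h'
    exact mul_right_cancel₀ hσ0 h'
  · have h' := congrArg σ h
    rw [map_mul, map_neg, AlgEquiv.commutes, ← h, mul_comm] at h'
    exact mul_right_cancel₀ hσ0 h'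

lemma biquadratic_gal_sq (ht : t ≠ 0)
    (σ : (X ^ 4 + C b * X ^ 2 + C (t ^ 2) : F[X]).Gal) : σ ^ 2 = 1 :=
  Gal.ext _ fun _ hx => algEquiv_apply_apply_biquadratic_root ht σ
    (aeval_biquadratic_eq_zero.1 (mem_rootSet.1 hx).2)

lemma card_biquadratic_gal [CharZero F] (ht : t ≠ 0)
    (hirr : Irreducible (X ^ 4 + C b * X ^ 2 + C (t ^ 2) : F[X])) :
    Nat.card (X ^ 4 + C b * X ^ 2 + C (t ^ 2) : F[X]).Gal = 4 := by
  rw [Gal.card_of_separable hirr.separable]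
  have hdeg := natDegree_biquadratic b (t ^ 2)
  have hmonic := monic_biquadratic b (t ^ 2)
  have hroot (L : Type u) [Field L] [Algebra F L] (x : L) :=
    aeval_biquadratic_eq_zero (b := b) (t := t) (x := x)
  generalize (X ^ 4 + C b * X ^ 2 + C (t ^ 2) : F[X]) = f at *
  obtain ⟨x, hx⟩ : ∃ x : f.SplittingField, aeval x f = 0 := by
    obtain ⟨x, hx⟩ := (SplittingField.splits f).exists_eval_eq_zero
      (by rw [degree_map]; exact hirr.degree_pos.ne')
    exact ⟨x, by rwa [eval_map_algebraMap] at hx⟩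
  have hint : IsIntegral F x := ⟨f, hmonic, hx⟩
  have hx' := (hroot _ x).1 hx
  have hx0 : x ≠ 0 :=
    ne_zero_of_biquadratic_root ((_root_.map_ne_zero (algebraMap F _)).2 ht) hx'
  have hmem : x ∈ F⟮x⟯ := IntermediateField.mem_adjoin_simple_self F x
  have htop : F⟮x⟯ = ⊤ := by
    rw [← top_le_iff, ← IntermediateField.toSubalgebra_le_toSubalgebra,
      IntermediateField.top_toSubalgebra, ← SplittingField.adjoin_rootSet f, Algebra.adjoin_le_iff]
    intro y hy
    have hy' := (hroot _ y).1 (mem_rootSet.1 hy).2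
    change y ∈ F⟮x⟯
    have ht' := F⟮x⟯.algebraMap_mem t
    rcases biquadratic_roots hx' hy' with (h | h) | (h | h)
    · rwa [h]
    · rw [h]; exact neg_mem hmem
    · rw [(eq_div_of_mul_eq hx0 ((mul_comm y x).trans h) : y = _)]
      exact div_mem ht' hmem
    · rw [(eq_div_of_mul_eq hx0 ((mul_comm y x).trans h) : y = _)]
      exact div_mem (neg_mem ht') hmem
  rw [← IntermediateField.finrank_top', ← htop, IntermediateField.adjoin.finrank hint,
    ← minpoly.eq_of_irreducible_of_monic hirr hx hmonic, hdeg]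

lemma isKleinFour_biquadratic_gal [CharZero F] (ht : t ≠ 0)
    (hirr : Irreducible (X ^ 4 + C b * X ^ 2 + C (t ^ 2) : F[X])) :
    IsKleinFour (X ^ 4 + C b * X ^ 2 + C (t ^ 2) : F[X]).Gal where
  card_four := card_biquadratic_gal ht hirr
  exponent_two := by
    have hcard := card_biquadratic_gal ht hirr
    have : Nontrivial (X ^ 4 + C b * X ^ 2 + C (t ^ 2) : F[X]).Gal :=
      by
      have := Nat.finite_of_card_ne_zero (hcard.trans_ne (by norm_num))
      exact Finite.one_lt_card_iff_nontrivial.1 (by rw [hcard]; norm_num)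
    refine ((Nat.dvd_prime Nat.prime_two).1
      (Monoid.exponent_dvd_of_forall_pow_eq_one (biquadratic_gal_sq ht))).resolve_left fun h => ?_
    exact not_subsingleton _ (Monoid.exp_eq_one_iff.1 h)

end Gal

lemma not_isSquare_biquadratic_discr (m k : ℤ) :
    ¬ IsSquare (((3 * m : ℤ) : ℚ) ^ 2 - 4 * ((3 * k + 1 : ℤ) : ℚ) ^ 2) := by
  have h : (((3 * m : ℤ) : ℚ) ^ 2 - 4 * ((3 * k + 1 : ℤ) : ℚ) ^ 2)
      = ((3 * (3 * m ^ 2 - 12 * k ^ 2 - 8 * k - 2) + 2 : ℤ) : ℚ) := by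
    push_cast; ring
  rw [h, Rat.isSquare_intCast_iff]
  rintro ⟨r, hr⟩
  have h2 : r * r % 3 = 2 := by omega
  rcases (by omega : r % 3 = 0 ∨ r % 3 = 1 ∨ r % 3 = 2) with h | h | h <;>
    simp [Int.mul_emod, h] at h2

end

lemma finite_bounded_quadruples (H : ℝ) :
    {p : ℤ × ℤ × ℤ × ℤ | |(p.1 : ℝ)| ≤ H ∧ |(p.2.1 : ℝ)| ≤ H ∧ |(p.2.2.1 : ℝ)| ≤ H ∧
      |(p.2.2.2 : ℝ)| ≤ H}.Finite := by
  have hI : {a : ℤ | |(a : ℝ)| ≤ H}.Finite := by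
    refine (Set.finite_Icc (-⌊H⌋) ⌊H⌋).subset fun a ha => ?_
    rw [Set.mem_ofPred_eq, ← Int.cast_abs, ← Int.le_floor] at ha
    exact abs_le.1 ha
  exact (hI.prod (hI.prod (hI.prod hI))).subset fun p hp => hp

lemma pow_three_le_quarticGalCount {H : ℝ} {n : ℕ} (hn : 36 * (n : ℝ) ^ 2 ≤ H) :
    n ^ 3 ≤ quarticGalCount (Multiplicative (ZMod 2 × ZMod 2)) H := by
  set S : Finset (ℕ × ℕ) := Finset.range (n ^ 2) ×ˢ Finset.range n
  set φ : ℕ × ℕ → ℤ × ℤ × ℤ × ℤ := fun q => (0, 3 * (2 * n + q.1), 0, (3 * q.2 + 1) ^ 2)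
  have hφ : Function.Injective φ := by
    rintro ⟨i, k⟩ ⟨j, l⟩ h
    simp only [φ, Prod.mk.injEq] at h
    obtain ⟨-, h1, -, h2⟩ := h
    have h3 := (sq_eq_sq₀ (by positivity) (by positivity)).1 h2
    ext <;> simp <;> omega
  have hS : S.card = n ^ 3 := by simp [S]; ring
  rw [← hS, ← Set.ncard_coe_finset, ← Set.ncard_image_of_injective _ hφ]
  refine Set.ncard_le_ncard ?_ ((finite_bounded_quadruples H).subset
    fun p hp => ⟨hp.1, hp.2.1, hp.2.2.1, hp.2.2.2.1⟩)
  rintro _ ⟨⟨i, k⟩, hik, rfl⟩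
  simp only [S, Finset.coe_product, Finset.coe_range, Set.mem_prod, Set.mem_Iio] at hik
  obtain ⟨hi, hk⟩ := hik
  have hi' : (i : ℝ) ≤ (n : ℝ) ^ 2 := by exact_mod_cast hi.le
  have hk' : (k : ℝ) + 1 ≤ n := by exact_mod_cast hk
  have hkQ : (k : ℚ) + 1 ≤ n := by exact_mod_cast hk
  have hk0 : (0 : ℝ) ≤ k := k.cast_nonneg
  have hirr := irreducible_biquadratic (b := ((3 * (2 * n + i : ℤ) : ℤ) : ℚ))
    (t := ((3 * k + 1 : ℤ) : ℚ)) (by push_cast; positivity)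
    (by push_cast; linarith [(Nat.cast_nonneg i : (0 : ℚ) ≤ i)])
    (not_isSquare_biquadratic_discr _ _)
  refine ⟨?_, ?_, ?_, ?_, ?_, ?_⟩
  · simpa [φ] using le_trans (by positivity) hn
  · simp only [φ]; push_cast
    rw [abs_of_nonneg (by positivity)]
    nlinarith
  · simpa [φ] using le_trans (by positivity) hn
  · simp only [φ]; push_cast
    rw [abs_of_nonneg (by positivity)]
    nlinarith
  · simp only [φ]
    rwa [biquadratic_eq]
  · simp only [φ]
    rw [biquadratic_eq]
    have := isKleinFour_biquadratic_gal (by norm_cast) hirr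
    exact IsKleinFour.nonempty_mulEquiv

/-- The number of `V₄` quartics is bounded below by `c H^(3/2)`. -/
theorem V4_lower_bound :
    ∃ c H₀ : ℝ, 0 < c ∧ 2 ≤ H₀ ∧ ∀ H : ℝ, H₀ ≤ H →
      c * H ^ ((3 : ℝ) / 2) ≤ (quarticGalCount (Multiplicative (ZMod 2 × ZMod 2)) H : ℝ) := by
  refine ⟨1 / 1728, 144, by norm_num, by norm_num, fun H hH => ?_⟩
  have hH0 : 0 ≤ H := by linarith
  have hs : 12 ≤ √H := Real.le_sqrt_of_sq_le (by linarith)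
  have hfl : (⌊√H / 6⌋₊ : ℝ) ≤ √H / 6 := Nat.floor_le (by positivity)
  have hlt := Nat.lt_floor_add_one (√H / 6)
  have hcount : 36 * (⌊√H / 6⌋₊ : ℝ) ^ 2 ≤ H := by
    calc 36 * (⌊√H / 6⌋₊ : ℝ) ^ 2 ≤ 36 * (√H / 6) ^ 2 := by gcongr
      _ = H := by rw [div_pow, Real.sq_sqrt hH0]; ring
  have hpow : H ^ ((3 : ℝ) / 2) = √H ^ 3 := by
    rw [Real.sqrt_eq_rpow, ← Real.rpow_natCast, ← Real.rpow_mul hH0]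
    norm_num
  calc 1 / 1728 * H ^ ((3 : ℝ) / 2) = (√H / 12) ^ 3 := by rw [hpow]; ring
    _ ≤ (⌊√H / 6⌋₊ : ℝ) ^ 3 := by gcongr; linarith
    _ ≤ _ := by exact_mod_cast pow_three_le_quarticGalCount hcount
end

section
/- There exist constants c > 0 and H₀ ≥ 2 such that for all real H ≥ H₀ one has N_{A₄}(H) ≥ c·H. -/
open Polynomial Module IntermediateField

/-- The monic quartic `X ^ 4 + a X ^ 3 + b X ^ 2 + c X + d`. -/
noncomputable def monicQuartic {R : Type*} [CommRing R] (a b c d : R) : R[X] :=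
  X ^ 4 + C a * X ^ 3 + C b * X ^ 2 + C c * X + C d

/-- The discriminant of `monicQuartic a b c d`. -/
def quarticDisc {R : Type*} [CommRing R] (a b c d : R) : R :=
  256 * d ^ 3 - 192 * a * c * d ^ 2 - 128 * b ^ 2 * d ^ 2 + 144 * b * c ^ 2 * d - 27 * c ^ 4
    + 144 * a ^ 2 * b * d ^ 2 - 6 * a ^ 2 * c ^ 2 * d - 80 * a * b ^ 2 * c * d
    + 18 * a * b * c ^ 3 + 16 * b ^ 4 * d - 4 * b ^ 3 * c ^ 2 - 27 * a ^ 4 * d ^ 2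
    + 18 * a ^ 3 * b * c * d - 4 * a ^ 3 * c ^ 3 - 4 * a ^ 2 * b ^ 3 * d + a ^ 2 * b ^ 2 * c ^ 2

/-- The cubic resolvent of `monicQuartic a b c d`. -/
noncomputable def cubicResolvent {R : Type*} [CommRing R] (a b c d : R) : R[X] :=
  X ^ 3 + C (-b) * X ^ 2 + C (a * c - 4 * d) * X + C (4 * b * d - a ^ 2 * d - c ^ 2)

section CommRing

variable {R : Type*} [CommRing R]

theorem monic_monicQuartic [Nontrivial R] (a b c d : R) : (monicQuartic a b c d).Monic := by
  unfold monicQuartic; monicity!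

theorem natDegree_monicQuartic [Nontrivial R] (a b c d : R) :
    (monicQuartic a b c d).natDegree = 4 := by
  unfold monicQuartic; compute_degree!

theorem natDegree_cubicResolvent [Nontrivial R] (a b c d : R) :
    (cubicResolvent a b c d).natDegree = 3 := by
  unfold cubicResolvent; compute_degree!

theorem map_monicQuartic {S : Type*} [CommRing S] (f : R →+* S) (a b c d : R) :
    (monicQuartic a b c d).map f = monicQuartic (f a) (f b) (f c) (f d) := by
  simp [monicQuartic]

theorem coeff_monicQuartic (a b c d : R) :
    (monicQuartic a b c d).coeff 3 = a ∧ (monicQuartic a b c d).coeff 2 = b ∧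
      (monicQuartic a b c d).coeff 1 = c ∧ (monicQuartic a b c d).coeff 0 = d := by
  simp [monicQuartic, coeff_X, coeff_C]

theorem eq_monicQuartic_of_natDegree_eq_four {p : R[X]} (hp : p.Monic) (h : p.natDegree = 4) :
    p = monicQuartic (p.coeff 3) (p.coeff 2) (p.coeff 1) (p.coeff 0) := by
  conv_lhs => rw [hp.as_sum, h]
  simp only [Finset.sum_range_succ, Finset.sum_range_zero, monicQuartic]
  ring

theorem prod_X_sub_C_eq_monicQuartic (v : Fin 4 → R) :
    ∏ i, (X - C (v i)) = monicQuartic (-(v 0 + v 1 + v 2 + v 3))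
      (v 0 * v 1 + v 0 * v 2 + v 0 * v 3 + v 1 * v 2 + v 1 * v 3 + v 2 * v 3)
      (-(v 0 * v 1 * v 2 + v 0 * v 1 * v 3 + v 0 * v 2 * v 3 + v 1 * v 2 * v 3))
      (v 0 * v 1 * v 2 * v 3) := by
  rw [Fin.prod_univ_four, monicQuartic]
  simp only [C_neg, C_add, C_mul]
  ring

theorem coeffs_of_monicQuartic_eq_prod {a b c d : R} {v : Fin 4 → R}
    (h : monicQuartic a b c d = ∏ i, (X - C (v i))) :
    a = -(v 0 + v 1 + v 2 + v 3) ∧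
      b = v 0 * v 1 + v 0 * v 2 + v 0 * v 3 + v 1 * v 2 + v 1 * v 3 + v 2 * v 3 ∧
      c = -(v 0 * v 1 * v 2 + v 0 * v 1 * v 3 + v 0 * v 2 * v 3 + v 1 * v 2 * v 3) ∧
      d = v 0 * v 1 * v 2 * v 3 := by
  rw [prod_X_sub_C_eq_monicQuartic] at h
  obtain ⟨h3, h2, h1, h0⟩ := coeff_monicQuartic a b c d
  rw [h] at h3 h2 h1 h0
  refine ⟨h3.symm.trans ?_, h2.symm.trans ?_, h1.symm.trans ?_, h0.symm.trans ?_⟩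
  exacts [(coeff_monicQuartic _ _ _ _).1, (coeff_monicQuartic _ _ _ _).2.1,
    (coeff_monicQuartic _ _ _ _).2.2.1, (coeff_monicQuartic _ _ _ _).2.2.2]

theorem det_vandermonde_sq_eq_quarticDisc {a b c d : R} {v : Fin 4 → R}
    (h : monicQuartic a b c d = ∏ i, (X - C (v i))) :
    (Matrix.vandermonde v).det ^ 2 = quarticDisc a b c d := by
  obtain ⟨rfl, rfl, rfl, rfl⟩ := coeffs_of_monicQuartic_eq_prod h
  have h1 : Finset.Ioi (1 : Fin 4) = {2, 3} := by decide
  have h2 : Finset.Ioi (2 : Fin 4) = {3} := by decide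
  have h3 : Finset.Ioi (3 : Fin 4) = ∅ := by decide
  have h0 : Finset.Ioi (0 : Fin 4) = {1, 2, 3} := by decide
  have hdet : (Matrix.vandermonde v).det = ((v 1 - v 0) * ((v 2 - v 0) * (v 3 - v 0))) *
      ((v 2 - v 1) * (v 3 - v 1)) * (v 3 - v 2) := by
    simp [Matrix.det_vandermonde, Fin.prod_univ_four, h0, h1, h2, h3]
  rw [hdet, quarticDisc]
  ring

theorem eval_cubicResolvent {a b c d : R} {v : Fin 4 → R}
    (h : monicQuartic a b c d = ∏ i, (X - C (v i))) :
    (cubicResolvent a b c d).eval (v 0 * v 1 + v 2 * v 3) = 0 := by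
  obtain ⟨rfl, rfl, rfl, rfl⟩ := coeffs_of_monicQuartic_eq_prod h
  simp only [cubicResolvent, eval_add, eval_mul, eval_pow, eval_X, eval_C]
  ring

theorem map_cubicResolvent {S : Type*} [CommRing S] (f : R →+* S) (a b c d : R) :
    (cubicResolvent a b c d).map f = cubicResolvent (f a) (f b) (f c) (f d) := by
  simp [cubicResolvent, map_ofNat f]

theorem map_quarticDisc {S : Type*} [CommRing S] (f : R →+* S) (a b c d : R) :
    f (quarticDisc a b c d) = quarticDisc (f a) (f b) (f c) (f d) := by
  simp [quarticDisc, map_ofNat f]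

end CommRing

theorem Irreducible.natDegree_dvd_finrank {F E : Type*} [Field F] [Field E] [Algebra F E]
    [FiniteDimensional F E] {q : F[X]} (hq : Irreducible q) {x : E} (hx : aeval x q = 0) :
    q.natDegree ∣ finrank F E := by
  have h := minpoly.degree_dvd (IsIntegral.of_finite F x)
  rwa [← minpoly.eq_of_irreducible hq hx, natDegree_mul_C] at h
  exact inv_ne_zero (leadingCoeff_ne_zero.mpr hq.ne_zero)

theorem gal_equiv_alternatingGroup {F : Type*} [Field F] [CharZero F] {a b c d δ : F}
    (hirr : Irreducible (monicQuartic a b c d)) (hres : Irreducible (cubicResolvent a b c d))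
    (hδ : quarticDisc a b c d = δ ^ 2) :
    Nonempty ((monicQuartic a b c d).Gal ≃* alternatingGroup (Fin 4)) := by
  classical
  set f := monicQuartic a b c d with hf
  set E := f.SplittingField
  have hdeg : f.natDegree = 4 := natDegree_monicQuartic a b c d
  have hsplits : (f.map (algebraMap F E)).Splits := SplittingField.splits f
  have : Fact ((f.map (algebraMap F E)).Splits) := ⟨hsplits⟩
  have hcard : Fintype.card (f.rootSet E) = Fintype.card (Fin 4) := by
    rw [card_rootSet_eq_natDegree hirr.separable hsplits, hdeg, Fintype.card_fin]
  let e : f.rootSet E ≃ Fin 4 := Fintype.equivOfCardEq hcard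
  let v : Fin 4 → E := fun i => e.symm i
  have hv : Function.Injective v := Subtype.val_injective.comp e.symm.injective
  have hfprod : f.map (algebraMap F E) = ∏ i, (X - C (v i)) := by
    rw [hsplits.eq_prod_roots_of_monic ((monic_monicQuartic a b c d).map _)]
    have h1 : ∏ i, (X - C (v i)) = ∏ x : f.rootSet E, (X - C (x : E)) :=
      e.symm.prod_comp fun x : f.rootSet E => (X - C (x : E))
    rw [h1, ← Finset.prod_subtype (f.aroots E).toFinset (by simp [rootSet_def])
      fun x => X - C x, Finset.prod, Multiset.toFinset_val, Multiset.dedup_eq_self.mpr]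
    exact nodup_roots hirr.separable.map
  have hprod := (map_monicQuartic (algebraMap F E) a b c d).symm.trans hfprod
  have hdet : (Matrix.vandermonde v).det ^ 2 = algebraMap F E δ ^ 2 := by
    rw [det_vandermonde_sq_eq_quarticDisc hprod, ← map_quarticDisc, hδ, map_pow]
  have hdet0 : (Matrix.vandermonde v).det ≠ 0 := Matrix.det_vandermonde_ne_zero_iff.mpr hv
  have hfix (τ : E ≃ₐ[F] E) : τ (Matrix.vandermonde v).det = (Matrix.vandermonde v).det := by
    rcases sq_eq_sq_iff_eq_or_eq_neg.mp hdet with h | h <;> simp [h]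
  let ψ : f.Gal →* Equiv.Perm (Fin 4) :=
    e.permCongrHom.toMonoidHom.comp (Gal.galActionHom f E)
  have hψ : Function.Injective ψ :=
    e.permCongrHom.injective.comp (Gal.galActionHom_injective f E)
  have hsign (σ : f.Gal) : ψ σ ∈ alternatingGroup (Fin 4) := by
    obtain ⟨τ, rfl⟩ := Gal.restrict_surjective f E σ
    set π := ψ (Gal.restrict f E τ) with hπ
    have hv' (i : Fin 4) : v (π i) = τ (v i) := by
      simp [hπ, ψ, v, Gal.galActionHom_restrict]
    have h1 : (Matrix.vandermonde v).submatrix π id = τ.toRingEquiv.toRingHom.mapMatrix (Matrix.vandermonde v) := by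
      ext i j
      simp [Matrix.vandermonde_apply, hv']
    have h2 := Matrix.det_permute π (Matrix.vandermonde v)
    rw [h1, ← RingHom.map_det] at h2
    have h3 : (((Equiv.Perm.sign π : ℤˣ) : ℤ) : E) = 1 := by
      have h4 := hfix τ
      refine mul_right_cancel₀ hdet0 (h2.symm.trans ?_)
      rw [one_mul]
      exact h4
    rw [Equiv.Perm.mem_alternatingGroup]
    simpa using h3
  have hdvd : 12 ∣ Nat.card f.Gal := by
    rw [Gal.card_of_separable hirr.separable]
    have h4 : 4 ∣ finrank F E := hdeg ▸ hirr.natDegree_dvd_finrank (x := v 0) (by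
      rw [← eval_map_algebraMap, hfprod, eval_prod]
      exact Finset.prod_eq_zero (Finset.mem_univ 0) (by simp))
    have h3 : 3 ∣ finrank F E := natDegree_cubicResolvent a b c d ▸
      hres.natDegree_dvd_finrank (x := v 0 * v 1 + v 2 * v 3) (by
        rw [← eval_map_algebraMap, map_cubicResolvent, eval_cubicResolvent hprod])
    exact (show Nat.Coprime 3 4 by norm_num).mul_dvd_of_dvd_of_dvd h3 h4
  let χ : f.Gal →* alternatingGroup (Fin 4) := ψ.codRestrict _ hsign
  have hχ : Function.Injective χ := fun x y h => hψ (congrArg Subtype.val h)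
  refine ⟨MulEquiv.ofBijective χ (hχ.bijective_of_nat_card_le ?_)⟩
  have hA : Nat.card (alternatingGroup (Fin 4)) = 12 := by
    rw [nat_card_alternatingGroup]; simp [Nat.factorial]
  rw [hA]
  exact Nat.le_of_dvd Nat.card_pos hdvd


theorem irreducible_monicQuartic_neg_two_two_zero_two : Irreducible (monicQuartic (-2 : ℚ) 2 0 2) := by
  have h : Irreducible (monicQuartic (-2 : ℤ) 2 0 2) := by
    have hp : (Ideal.span {(2 : ℤ)}).IsPrime :=
      (Ideal.span_singleton_prime two_ne_zero).mpr Int.prime_two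
    refine irreducible_of_eisenstein_criterion hp ?_ ?_ ?_ ?_ (monic_monicQuartic _ _ _ _).isPrimitive
    · rw [(monic_monicQuartic _ _ _ _).leadingCoeff, Ideal.mem_span_singleton]; decide
    · intro n hn
      rw [degree_eq_natDegree (monic_monicQuartic _ _ _ _).ne_zero, natDegree_monicQuartic] at hn
      have hn : n < 4 := by exact_mod_cast hn
      obtain ⟨h3, h2, h1, h0⟩ := coeff_monicQuartic (-2 : ℤ) 2 0 2
      rw [Ideal.mem_span_singleton]
      interval_cases n <;> simp [h3, h2, h1, h0]
    · rw [degree_eq_natDegree (monic_monicQuartic _ _ _ _).ne_zero, natDegree_monicQuartic]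
      norm_num
    · rw [(coeff_monicQuartic _ _ _ _).2.2.2, Ideal.span_singleton_pow, Ideal.mem_span_singleton]
      decide
  have := ((monic_monicQuartic _ _ _ _).irreducible_iff_irreducible_map_fraction_map (K := ℚ)).mp h
  simpa [map_monicQuartic] using this

theorem irreducible_cubicResolvent_neg_two_two_zero_two : Irreducible (cubicResolvent (-2 : ℚ) 2 0 2) := by
  have hm : (cubicResolvent (-2 : ℤ) 2 0 2).Monic := by unfold cubicResolvent; monicity!
  have h : Irreducible (cubicResolvent (-2 : ℤ) 2 0 2) := by
    rw [hm.irreducible_iff_roots_eq_zero_of_degree_le_three (by simp [natDegree_cubicResolvent]) (by simp [natDegree_cubicResolvent])]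
    refine Multiset.eq_zero_of_forall_notMem fun x hx => ?_
    have := (mem_roots'.mp hx).2
    have h3 := congrArg (Int.cast : ℤ → ZMod 3) this
    simp only [cubicResolvent, eval_add, eval_mul, eval_pow, eval_X, eval_C] at h3
    push_cast at h3
    generalize (x : ZMod 3) = y at h3
    revert y
    decide
  have := (hm.irreducible_iff_irreducible_map_fraction_map (K := ℚ)).mp h
  simpa [map_cubicResolvent] using this

theorem alternatingGroup_index_ne_two {ι : Type*} [Fintype ι] [DecidableEq ι]
    (H : Subgroup (alternatingGroup ι)) : H.index ≠ 2 := by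
  intro hH
  have hle : alternatingGroup ι ≤ H.map (alternatingGroup ι).subtype := by
    refine Equiv.Perm.closure_three_cycles_eq_alternating.symm.le.trans ?_
    rw [Subgroup.closure_le]
    intro σ hσ
    have hσ' : σ ∈ alternatingGroup ι := Equiv.Perm.IsThreeCycle.mem_alternatingGroup hσ
    refine ⟨(⟨σ, hσ'⟩ ^ 2) ^ 2, Subgroup.sq_mem_of_index_two hH _, ?_⟩
    have h3 : σ ^ 3 = 1 := hσ.orderOf ▸ pow_orderOf_eq_one σ
    simp only [map_pow, Subgroup.subtype_apply]
    rw [← pow_mul, pow_succ, h3, one_mul]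
  have htop : H = ⊤ := by
    rw [eq_top_iff]
    intro x _
    obtain ⟨y, hy, hyx⟩ := hle x.2
    rwa [← Subtype.ext hyx]
  simp [htop] at hH

theorem finrank_ne_two_of_gal_equiv_alternatingGroup {F E ι : Type*} [Field F] [Field E] [Algebra F E]
    [FiniteDimensional F E] [IsGalois F E] [Fintype ι] [DecidableEq ι] (e : (E ≃ₐ[F] E) ≃* alternatingGroup ι)
    (K : IntermediateField F E) : finrank F K ≠ 2 := by
  rw [IntermediateField.finrank_eq_fixingSubgroup_index]
  have := alternatingGroup_index_ne_two (K.fixingSubgroup.map (e : (E ≃ₐ[F] E) →* alternatingGroup ι))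
  rwa [Subgroup.index_map_equiv] at this

section
variable {F : Type*} [Field F] {f : F[X]} {θ α : f.SplittingField}

theorem adjoin_eq_of_mem_adjoin_root [CharZero F] {ι : Type*} [Fintype ι] [DecidableEq ι]
    (hf : Irreducible f) (hdeg : f.natDegree = 4)
    (e : f.Gal ≃* alternatingGroup ι) (hθ : aeval θ f = 0) (hα : α ∈ F⟮θ⟯)
    (hα' : α ∉ (⊥ : IntermediateField F f.SplittingField)) :
    F⟮α⟯ = F⟮θ⟯ ∧ (minpoly F α).natDegree = 4 := by
  have : IsGalois F f.SplittingField := IsGalois.of_separable_splitting_field hf.separable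
  have hfin : finrank F F⟮θ⟯ = 4 := by
    rw [adjoin.finrank (.of_finite F θ), ← hdeg, ← minpoly.eq_of_irreducible hf hθ,
      natDegree_mul_C (inv_ne_zero (leadingCoeff_ne_zero.mpr hf.ne_zero))]
  have hle : F⟮α⟯ ≤ F⟮θ⟯ := adjoin_simple_le_iff.mpr hα
  have hdvd : finrank F F⟮α⟯ ∣ 4 := hfin ▸ finrank_dvd_of_le_right hle
  have h2 : finrank F F⟮α⟯ ≠ 2 := finrank_ne_two_of_gal_equiv_alternatingGroup e _
  have h1 : finrank F F⟮α⟯ ≠ 1 := by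
    rwa [Ne, finrank_adjoin_simple_eq_one_iff]
  have h4 : finrank F F⟮α⟯ = 4 := by
    have := Nat.le_of_dvd (by norm_num) hdvd
    interval_cases finrank F F⟮α⟯ <;> omega
  exact ⟨eq_of_le_of_finrank_eq hle (h4.trans hfin.symm),
    by rw [← adjoin.finrank (.of_finite F α), h4]⟩

theorem isSplittingField_minpoly_of_mem_adjoin (hf : Irreducible f) (hθ : aeval θ f = 0)
    (h : θ ∈ F⟮α⟯) : IsSplittingField F f.SplittingField (minpoly F α) := by
  have : Normal F f.SplittingField := Normal.of_isSplittingField f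
  have hs := Normal.splits (F := F) inferInstance α
  rw [isSplittingField_iff_intermediateField]
  refine ⟨hs, ?_⟩
  set N := adjoin F ((minpoly F α).rootSet f.SplittingField) with hN
  have : IsSplittingField F N (minpoly F α) := adjoin_rootSet_isSplittingField hs
  have : Normal F N := Normal.of_isSplittingField (minpoly F α)
  have hαN : α ∈ N := subset_adjoin _ _ ((mem_rootSet).mpr ⟨minpoly.ne_zero (.of_finite F α), minpoly.aeval F α⟩)
  have hθN : θ ∈ N := adjoin_simple_le_iff.mpr hαN h
  have hdvd : f ∣ minpoly F (⟨θ, hθN⟩ : N) := by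
    rw [IntermediateField.minpoly_eq, ← minpoly.eq_of_irreducible hf hθ]
    exact dvd_mul_right _ _
  have hfN : (f.map (algebraMap F N)).Splits :=
    (Normal.splits (F := F) inferInstance (⟨θ, hθN⟩ : N)).of_dvd
      (map_ne_zero (minpoly.ne_zero (.of_finite F _))) (Polynomial.map_dvd _ hdvd)
  have hsf : IsSplittingField F f.SplittingField f := inferInstance
  rw [eq_top_iff, ← (isSplittingField_iff_intermediateField.mp hsf).2, adjoin_le_iff]
  exact (splits_iff_mem (SplittingField.splits f)).mp hfN

theorem gal_minpoly_equiv_of_mem_adjoin (hf : Irreducible f) (hθ : aeval θ f = 0)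
    (h : θ ∈ F⟮α⟯) : Nonempty ((minpoly F α).Gal ≃* f.Gal) := by
  have := isSplittingField_minpoly_of_mem_adjoin hf hθ h
  exact ⟨(IsSplittingField.algEquiv f.SplittingField (minpoly F α)).autCongr.symm⟩
end

/-- The integer combination `x 0 + x 1 θ + x 2 θ ^ 2 + x 3 θ ^ 3`. -/
def intCombPow {R : Type*} [CommRing R] (θ : R) (x : Fin 4 → ℤ) : R :=
  ∑ i, (x i : R) * θ ^ (i : ℕ)

theorem intCombPow_injective {E : Type*} [Field E] [CharZero E] [Algebra ℚ E] {θ : E}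
    (hθ : (minpoly ℚ θ).natDegree = 4) {x y : Fin 4 → ℤ} {q : ℚ}
    (h : intCombPow θ x - intCombPow θ y = algebraMap ℚ E q) :
    (q : ℚ) = x 0 - y 0 ∧ x 1 = y 1 ∧ x 2 = y 2 ∧ x 3 = y 3 := by
  have hli : LinearIndependent ℚ fun i : Fin 4 => θ ^ (i : ℕ) :=
    (linearIndependent_pow θ).comp (finCongr hθ.symm) (finCongr hθ.symm).injective
  rw [Fintype.linearIndependent_iff] at hli
  have key := hli ![x 0 - y 0 - q, x 1 - y 1, x 2 - y 2, x 3 - y 3] (by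
    simp only [intCombPow, Fin.sum_univ_four] at h
    simp [Fin.sum_univ_four, Algebra.smul_def] at h ⊢
    linear_combination h)
  have k0 := key 0
  have k1 := key 1
  have k2 := key 2
  have k3 := key 3
  simp [sub_eq_zero] at k0 k1 k2 k3
  exact ⟨k0.symm, k1, k2, k3⟩

theorem isIntegral_intCombPow {R : Type*} [CommRing R] {θ : R} (hθ : IsIntegral ℤ θ)
    (x : Fin 4 → ℤ) : IsIntegral ℤ (intCombPow θ x) :=
  IsIntegral.sum _ fun i _ => (isIntegral_algebraMap (x := x i)).mul (hθ.pow _)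

theorem map_intCombPow {R S : Type*} [CommRing R] [CommRing S] (φ : R →+* S) (θ : R)
    (x : Fin 4 → ℤ) : φ (intCombPow θ x) = intCombPow (φ θ) x := by
  simp [intCombPow]

theorem norm_intCombPow_le {z : ℂ} (hz : ‖z‖ ≤ 3) {n : ℕ} {x : Fin 4 → ℤ}
    (hx : ∀ i, x i ∈ Finset.Icc (1 : ℤ) n) : ‖intCombPow z x‖ ≤ 40 * n := by
  have hx' (i : Fin 4) : ‖(x i : ℂ)‖ ≤ n := by
    have h := Finset.mem_Icc.mp (hx i)
    rw [Complex.norm_intCast, ← Int.cast_abs, abs_of_nonneg (by omega)]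
    exact_mod_cast h.2
  calc ‖intCombPow z x‖ ≤ ∑ i : Fin 4, (n : ℝ) * 3 ^ (i : ℕ) := by
        refine norm_sum_le_of_le _ fun i _ => ?_
        rw [norm_mul, norm_pow]
        gcongr
        exact hx' i
    _ = 40 * n := by
        simp [Fin.sum_univ_four]
        ring

theorem norm_coeff_minpoly_intCombPow_le {E : Type*} [Field E] [NumberField E] {θ : E}
    (hθ : ∀ φ : E →+* ℂ, ‖φ θ‖ ≤ 3) (hint : IsIntegral ℤ θ) {n : ℕ} (hn : 1 ≤ n) {x : Fin 4 → ℤ}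
    (hx : ∀ i, x i ∈ Finset.Icc (1 : ℤ) n) (hdeg : (minpoly ℚ (intCombPow θ x)).natDegree = 4)
    (i : ℕ) : |((minpoly ℤ (intCombPow θ x)).coeff i : ℝ)| ≤ 6 * 40 ^ 4 * n ^ 4 := by
  set α := intCombPow θ x with hα
  have hαint : IsIntegral ℤ α := isIntegral_intCombPow hint x
  have h := coeff_bdd_of_roots_le (K := ℂ) (B := 40 * n) (d := 4) (algebraMap ℚ ℂ)
    (minpoly.monic (IsIntegral.of_finite ℚ α)) (IsAlgClosed.splits _) hdeg.le (fun z hz => by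
      have hz' : z ∈ (minpoly ℚ α).rootSet ℂ := by
        classical
        rw [rootSet_def]
        exact Multiset.mem_toFinset.mpr hz
      obtain ⟨φ, rfl⟩ := (NumberField.Embeddings.range_eval_eq_rootSet_minpoly E ℂ α).symm.subset hz'
      simp only [hα, map_intCombPow]
      exact norm_intCombPow_le (hθ φ) hx) i
  have hn' : (1 : ℝ) ≤ n := by exact_mod_cast hn
  rw [max_eq_left (by linarith), minpoly.isIntegrallyClosed_eq_field_fractions' ℚ hαint,
    coeff_map, coeff_map] at h
  have h2 : ((4 : ℕ).choose (4 / 2) : ℝ) = 6 := by norm_num [Nat.choose]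
  rw [h2] at h
  simp at h
  calc _ ≤ _ := h
    _ = _ := by ring
theorem norm_le_three_of_eval_eq_zero {z : ℂ} (h : (monicQuartic (-2 : ℂ) 2 0 2).eval z = 0) :
    ‖z‖ ≤ 3 := by
  by_contra! hz
  have hz4 : z ^ 4 = 2 * z ^ 3 - 2 * z ^ 2 - 2 := by
    simp only [monicQuartic, eval_add, eval_mul, eval_pow, eval_X, eval_C] at h
    linear_combination h
  have hn : ‖z‖ ^ 4 ≤ 2 * ‖z‖ ^ 3 + 2 * ‖z‖ ^ 2 + 2 :=
    calc ‖z‖ ^ 4 = ‖2 * z ^ 3 - 2 * z ^ 2 - 2‖ := by rw [← hz4, norm_pow]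
      _ ≤ ‖2 * z ^ 3‖ + ‖2 * z ^ 2‖ + ‖(2 : ℂ)‖ := norm_sub_le_of_le (norm_sub_le _ _) le_rfl
      _ = 2 * ‖z‖ ^ 3 + 2 * ‖z‖ ^ 2 + 2 := by simp
  nlinarith [pow_pos (norm_pos_iff.mpr (norm_pos_iff.mp (lt_trans three_pos hz))) 2,
    mul_pos (sub_pos.mpr hz) (pow_pos (lt_trans three_pos hz) 2),
    mul_pos (sub_pos.mpr hz) (pow_pos (lt_trans three_pos hz) 3)]

theorem finite_quarticGalCount_set (H : ℝ) (P : ℤ × ℤ × ℤ × ℤ → Prop) :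
    {p : ℤ × ℤ × ℤ × ℤ | |(p.1 : ℝ)| ≤ H ∧ |(p.2.1 : ℝ)| ≤ H ∧ |(p.2.2.1 : ℝ)| ≤ H ∧
      |(p.2.2.2 : ℝ)| ≤ H ∧ P p}.Finite := by
  have hI : {k : ℤ | |(k : ℝ)| ≤ H}.Finite := by
    refine (Set.finite_Icc (-⌊H⌋) ⌊H⌋).subset fun k hk => ?_
    have h : -H ≤ k ∧ (k : ℝ) ≤ H := abs_le.mp hk
    refine ⟨?_, Int.le_floor.mpr h.2⟩
    rw [neg_le, Int.le_floor]
    push_cast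
    linarith [h.1]
  exact (hI.prod (hI.prod (hI.prod hI))).subset fun p hp =>
    ⟨hp.1, hp.2.1, hp.2.2.1, hp.2.2.2.1⟩

theorem pow_four_le_quarticGalCount {n : ℕ} (hn : 1 ≤ n) {H : ℝ}
    (hH : 6 * 40 ^ 4 * (n : ℝ) ^ 4 ≤ H) :
    n ^ 4 ≤ 4 * quarticGalCount (alternatingGroup (Fin 4)) H := by
  classical
  set f := monicQuartic (-2 : ℚ) 2 0 2 with hf
  have hirr : Irreducible f := irreducible_monicQuartic_neg_two_two_zero_two
  have hdegf : f.natDegree = 4 := natDegree_monicQuartic _ _ _ _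
  obtain ⟨e⟩ : Nonempty (f.Gal ≃* alternatingGroup (Fin 4)) :=
    gal_equiv_alternatingGroup (δ := 56) hirr irreducible_cubicResolvent_neg_two_two_zero_two (by norm_num [quarticDisc])
  let E := f.SplittingField
  have : CharZero E := algebraRat.charZero E
  have : NumberField E := { }
  obtain ⟨θ, hθ⟩ : ∃ θ : E, aeval θ f = 0 := by
    obtain ⟨θ, hθ⟩ := (SplittingField.splits f).exists_eval_eq_zero (by
      rw [degree_map, degree_eq_natDegree hirr.ne_zero, hdegf]; norm_num)
    exact ⟨θ, by rwa [← eval_map_algebraMap]⟩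
  have hmap {R : Type} [CommRing R] (g : ℚ →+* R) : f.map g = monicQuartic (-2) 2 0 2 := by
    rw [hf, map_monicQuartic]
    simp [map_ofNat g]
  have hθdeg : (minpoly ℚ θ).natDegree = 4 := by
    rw [← minpoly.eq_of_irreducible_of_monic hirr hθ (monic_monicQuartic _ _ _ _), hdegf]
  have hθint : IsIntegral ℤ θ := by
    refine ⟨monicQuartic (-2) 2 0 2, monic_monicQuartic _ _ _ _, ?_⟩
    rw [← eval_map_algebraMap, hmap] at hθ
    rw [← eval_map, map_monicQuartic]
    simpa using hθ
  have hθnorm (φ : E →+* ℂ) : ‖φ θ‖ ≤ 3 := by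
    refine norm_le_three_of_eval_eq_zero ?_
    have h := congrArg φ hθ
    rwa [map_zero, aeval_def, hom_eval₂, ← eval_map, hmap] at h
  let s : Finset (Fin 4 → ℤ) := Fintype.piFinset fun _ => Finset.Icc (1 : ℤ) n
  have hs : s.card = n ^ 4 := by simp [s, Fintype.card_piFinset]
  let m : (Fin 4 → ℤ) → ℤ[X] := fun x => minpoly ℤ (intCombPow θ x)
  let Φ : (Fin 4 → ℤ) → ℤ × ℤ × ℤ × ℤ := fun x =>
    ((m x).coeff 3, (m x).coeff 2, (m x).coeff 1, (m x).coeff 0)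
  have hm (x : Fin 4 → ℤ) : minpoly ℚ (intCombPow θ x) = (m x).map (algebraMap ℤ ℚ) :=
    minpoly.isIntegrallyClosed_eq_field_fractions' ℚ (isIntegral_intCombPow hθint x)
  have hmem (x : Fin 4 → ℤ) (hx : x ∈ s) : (minpoly ℚ (intCombPow θ x)).natDegree = 4 ∧
      Nonempty ((minpoly ℚ (intCombPow θ x)).Gal ≃* alternatingGroup (Fin 4)) := by
    have hα : intCombPow θ x ∈ ℚ⟮θ⟯ := sum_mem fun i _ =>
      mul_mem (intCast_mem _ _) (pow_mem (mem_adjoin_simple_self ℚ θ) _)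
    have hα' : intCombPow θ x ∉ (⊥ : IntermediateField ℚ E) := by
      rintro ⟨q, hq⟩
      have h := (intCombPow_injective hθdeg (y := 0) (q := q)
        (by simpa [intCombPow] using hq.symm)).2.1
      have h1 := (Finset.mem_Icc.mp (Fintype.mem_piFinset.mp hx 1)).1
      simp [h] at h1
    obtain ⟨hadj, hdeg⟩ := adjoin_eq_of_mem_adjoin_root hirr hdegf e hθ hα hα'
    obtain ⟨e'⟩ := gal_minpoly_equiv_of_mem_adjoin hirr hθ
      (hadj ▸ mem_adjoin_simple_self ℚ θ)
    exact ⟨hdeg, ⟨e'.trans e⟩⟩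
  have hquartic (x : Fin 4 → ℤ) (hx : x ∈ s) : minpoly ℚ (intCombPow θ x) =
      monicQuartic ((Φ x).1 : ℚ) ((Φ x).2.1 : ℚ) ((Φ x).2.2.1 : ℚ) ((Φ x).2.2.2 : ℚ) := by
    rw [eq_monicQuartic_of_natDegree_eq_four (minpoly.monic (.of_finite ℚ _)) (hmem x hx).1, hm]
    simp [Φ]
  have hfiber (b : ℤ × ℤ × ℤ × ℤ) : (s.filter fun x => Φ x = b).card ≤ 4 := by
    set q := monicQuartic (b.1 : ℚ) (b.2.1 : ℚ) (b.2.2.1 : ℚ) (b.2.2.2 : ℚ) with hq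
    have hqm : q.Monic := monic_monicQuartic _ _ _ _
    calc (s.filter fun x => Φ x = b).card ≤ (q.aroots E).toFinset.card := by
          refine Finset.card_le_card_of_injOn (intCombPow θ) (fun x hx => ?_) ?_
          · obtain ⟨hxs, rfl⟩ := Finset.mem_filter.mp hx
            rw [Finset.mem_coe, Multiset.mem_toFinset, mem_aroots]
            exact ⟨hqm.ne_zero, by rw [hq, ← hquartic x hxs]; exact minpoly.aeval _ _⟩
          · intro x _ y _ hxy
            obtain ⟨h0, h1, h2, h3⟩ := intCombPow_injective hθdeg (x := x) (y := y) (q := 0)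
              (by simpa [sub_eq_zero] using hxy)
            have h0 : x 0 = y 0 := by exact_mod_cast (sub_eq_zero.mp h0.symm)
            ext i
            fin_cases i <;> assumption
      _ ≤ (q.aroots E).card := Multiset.toFinset_card_le _
      _ ≤ q.natDegree := (card_roots' _).trans_eq (natDegree_map _)
      _ = 4 := natDegree_monicQuartic _ _ _ _
  rw [← hs]
  refine (Finset.card_le_mul_card_image s 4 fun b _ => hfiber b).trans ?_
  refine Nat.mul_le_mul_left 4 ?_
  rw [← Set.ncard_coe_finset]
  refine Set.ncard_le_ncard (fun b hb => ?_) (finite_quarticGalCount_set H fun p =>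
    Irreducible (monicQuartic (p.1 : ℚ) (p.2.1 : ℚ) (p.2.2.1 : ℚ) (p.2.2.2 : ℚ)) ∧
    Nonempty ((monicQuartic (p.1 : ℚ) (p.2.1 : ℚ) (p.2.2.1 : ℚ) (p.2.2.2 : ℚ)).Gal ≃*
      alternatingGroup (Fin 4)))
  obtain ⟨x, hx, rfl⟩ := Finset.mem_image.mp hb
  have hbound (i : ℕ) : |((m x).coeff i : ℝ)| ≤ H :=
    (norm_coeff_minpoly_intCombPow_le hθnorm hθint hn (Fintype.mem_piFinset.mp hx)
      (hmem x hx).1 i).trans hH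
  refine ⟨hbound 3, hbound 2, hbound 1, hbound 0, ?_⟩
  change Irreducible (monicQuartic _ _ _ _) ∧ Nonempty ((monicQuartic _ _ _ _).Gal ≃* _)
  rw [← hquartic x hx]
  exact ⟨minpoly.irreducible (.of_finite ℚ _), (hmem x hx).2⟩

/-- The number of `A₄` quartics is bounded below by `c H`. -/
theorem A4_lower_bound :
    ∃ c H₀ : ℝ, 0 < c ∧ 2 ≤ H₀ ∧ ∀ H : ℝ, H₀ ≤ H →
      c * H ≤ (quarticGalCount (alternatingGroup (Fin 4)) H : ℝ) := by
  refine ⟨1 / (64 * (6 * 40 ^ 4)), 6 * 40 ^ 4, by positivity, by norm_num, fun H hH => ?_⟩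
  set M : ℝ := 6 * 40 ^ 4 with hM
  have hM0 : 0 < M := by positivity
  have hHM : 1 ≤ H / M := (one_le_div hM0).mpr hH
  set r : ℝ := (H / M) ^ (1 / 4 : ℝ) with hr
  have hr4 : r ^ 4 = H / M := by
    rw [hr, ← Real.rpow_natCast, ← Real.rpow_mul (by positivity)]
    norm_num
  have hr1 : 1 ≤ r := Real.one_le_rpow hHM (by norm_num)
  have hn : 1 ≤ ⌊r⌋₊ := Nat.le_floor (by simpa using hr1)
  have hn' : (1 : ℝ) ≤ ⌊r⌋₊ := by exact_mod_cast hn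
  have hnr : (⌊r⌋₊ : ℝ) ^ 4 ≤ H / M :=
    hr4 ▸ pow_le_pow_left₀ (by positivity) (Nat.floor_le (by positivity)) 4
  have hrn : H / M ≤ 16 * (⌊r⌋₊ : ℝ) ^ 4 :=
    calc H / M = r ^ 4 := hr4.symm
      _ ≤ (2 * (⌊r⌋₊ : ℝ)) ^ 4 :=
        pow_le_pow_left₀ (by positivity) (by linarith [Nat.lt_floor_add_one r]) 4
      _ = 16 * (⌊r⌋₊ : ℝ) ^ 4 := by ring
  have hcount : (⌊r⌋₊ : ℝ) ^ 4 ≤ 4 * (quarticGalCount (alternatingGroup (Fin 4)) H : ℝ) := by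
    exact_mod_cast pow_four_le_quarticGalCount hn (mul_comm M _ ▸ (le_div_iff₀ hM0).mp hnr)
  have hc : 1 / (64 * M) * H = H / M / 64 := by ring
  rw [hc]
  linarith
end
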